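/- arXiv:1308.6044 — 4 statements merged into one kernel-verified Lean document; each statement's English description precedes it below -/
import Mathlib

section
/- Let (R, m) be a commutative Noetherian local ring that is Cohen-Macaulay. Then for any parameter ideals a and b of R with b ⊆ a, there is an isomorphism of R-modules Hom_R(R/a, R/b) ≅ R/a. -/
open IsLocalRing

/-- A parameter ideal of a Noetherian local ring: an ideal generated by a system of
parameters, i.e. by `d` elements of the maximal ideal (where `d` is the Krull dimension
of the ring) generating an ideal whose radical is the maximal ideal. -/
def IsParameterIdeal (R : Type*) [CommRing R] [IsLocalRing R] (I : Ideal R) : Prop :=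
  ∃ (d : ℕ) (a : Fin d → R), ringKrullDim R = d ∧ (∀ i, a i ∈ maximalIdeal R) ∧
    I = Ideal.span (Set.range a) ∧ I.radical = maximalIdeal R

/-- The depth of a Noetherian local ring `R`: the supremum of the lengths of
regular sequences consisting of elements of the maximal ideal. -/
noncomputable def ringDepth (R : Type*) [CommRing R] [IsLocalRing R] : ℕ∞ :=
  sSup {n : ℕ∞ | ∃ (k : ℕ) (a : Fin k → R), (k : ℕ∞) = n ∧
    (∀ i, a i ∈ maximalIdeal R) ∧ RingTheory.Sequence.IsRegular R (List.ofFn a)}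

/-- A Noetherian local ring is Cohen–Macaulay if its depth equals its Krull dimension. -/
def IsCohenMacaulayLocalRing (R : Type*) [CommRing R] [IsLocalRing R] : Prop :=
  (ringDepth R : WithBot ℕ∞) = ringKrullDim R

section Depth

open RingTheory.Sequence CategoryTheory Abelian Pointwise

universe u v

variable {R : Type u} [CommRing R] [IsNoetherianRing R] [IsLocalRing R]

/-- If `M` admits a regular sequence of length `n`, then every associated prime `p` of `M`
satisfies `n ≤ dim R ⧸ p`. -/
lemma RingTheory.Sequence.IsRegular.length_le_ringKrullDim_quotient {M : Type v} [AddCommGroup M]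
    [Module R M] [Module.Finite R M] {rs : List R} (reg : IsRegular M rs) {p : Ideal R}
    (hp : p ∈ associatedPrimes R M) : (rs.length : WithBot ℕ∞) ≤ ringKrullDim (R ⧸ p) := by
  induction rs generalizing M p with
  | nil =>
    have : p.IsPrime := IsAssociatedPrime.isPrime hp
    simpa using ringKrullDim_nonneg_of_nontrivial
  | cons x rs ih =>
    have hx : x ∈ maximalIdeal R := by
      simpa using fun isu ↦ reg.2 (by simp [Ideal.span_singleton_eq_top.mpr isu])
    obtain ⟨hxM, hrs⟩ := (isRegular_cons_iff M x rs).mp reg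
    obtain ⟨hprime, y, hy⟩ := isAssociatedPrime_iff.mp hp
    have mem_p (r : R) : r ∈ p ↔ r • y = 0 := by rw [hy]; simp
    have hy0 : y ≠ 0 := by
      rintro rfl
      exact hprime.ne_top ((Ideal.eq_top_iff_one _).mpr ((mem_p 1).mpr (by simp)))
    let N : Submodule R M := Submodule.torsionBySet R M p
    have hyN : y ∈ N := (Submodule.mem_torsionBySet_iff _ _).mpr fun r ↦ (mem_p r).mp r.2
    have : Nontrivial N := ⟨⟨⟨y, hyN⟩, 0, by simpa [Subtype.ext_iff] using hy0⟩⟩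
    have : Nontrivial (QuotSMulTop x N) := nontrivial_quotSMulTop_of_mem_maximalIdeal N hx
    have hinj : Function.Injective (QuotSMulTop.map x N.subtype) := by
      rw [← LinearMap.ker_eq_bot, LinearMap.ker_eq_bot']
      intro z
      induction z using Submodule.Quotient.induction_on with | _ n
      intro hn
      have hn' : (n : M) ∈ x • (⊤ : Submodule R M) := (Submodule.Quotient.mk_eq_zero _).mp hn
      obtain ⟨m, -, hm⟩ := Submodule.mem_smul_pointwise_iff_exists _ _ _ |>.mp hn'
      have hmN : m ∈ N := by
        refine (Submodule.mem_torsionBySet_iff _ _).mpr fun r ↦ hxM ?_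
        have := (Submodule.mem_torsionBySet_iff _ _).mp n.2 r
        rw [← hm, smul_comm] at this
        simpa using this
      refine (Submodule.Quotient.mk_eq_zero _).mpr
        (Submodule.mem_smul_pointwise_iff_exists _ _ _ |>.mpr ⟨⟨m, hmN⟩, trivial, ?_⟩)
      exact Subtype.ext hm
    obtain ⟨q, hq⟩ := associatedPrimes.nonempty R (QuotSMulTop x N)
    have hqprime : q.IsPrime := IsAssociatedPrime.isPrime hq
    have hann : Module.annihilator R (QuotSMulTop x N) ≤ q :=
      Submodule.annihilator_top.ge.trans <| IsAssociatedPrime.annihilator_le hq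
    have hpq : p ≤ q := by
      refine le_trans (fun r hr ↦ Module.mem_annihilator.mpr fun z ↦ ?_) hann
      induction z using Submodule.Quotient.induction_on with | _ n
      rw [← Submodule.Quotient.mk_smul]
      have : r • n = 0 := Subtype.ext ((Submodule.mem_torsionBySet_iff _ _).mp n.2 ⟨r, hr⟩)
      rw [this, Submodule.Quotient.mk_zero]
    have hxq : x ∈ q := by
      refine hann (Module.mem_annihilator.mpr fun z ↦ ?_)
      induction z using Submodule.Quotient.induction_on with | _ n
      exact (Submodule.Quotient.mk_eq_zero _).mpr
        (Submodule.smul_mem_pointwise_smul _ _ _ trivial)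
    have hxp : x ∉ p := fun h ↦ hy0 (hxM (by simpa using (mem_p x).mp h))
    have hdim : ringKrullDim (R ⧸ q) + 1 ≤ ringKrullDim (R ⧸ p) :=
      ringKrullDim_succ_le_of_surjective (Ideal.Quotient.factor hpq)
        (Ideal.Quotient.factor_surjective hpq) (r := Ideal.Quotient.mk p x)
        (mem_nonZeroDivisors_of_ne_zero (by rwa [ne_eq, Ideal.Quotient.eq_zero_iff_mem]))
        (by rwa [Ideal.Quotient.factor_mk, Ideal.Quotient.eq_zero_iff_mem])
    have hlen := ih hrs (associatedPrimes.subset_of_injective hinj hq)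
    calc ((x :: rs).length : WithBot ℕ∞) = rs.length + 1 := by simp
      _ ≤ ringKrullDim (R ⧸ q) + 1 := by gcongr
      _ ≤ _ := hdim

/-- If a prime `p` together with `n` elements generates an ideal with radical containing the
maximal ideal, then `dim R ⧸ p ≤ n`. -/
lemma ringKrullDim_quotient_le_length_of_le_radical {p : Ideal R} [p.IsPrime] (rs : List R)
    (h : maximalIdeal R ≤ (p ⊔ Ideal.ofList rs).radical) (hrs : ∀ r ∈ rs, r ∈ maximalIdeal R) :
    ringKrullDim (R ⧸ p) ≤ rs.length := by
  have : IsLocalRing (R ⧸ p) := .of_surjective' _ Ideal.Quotient.mk_surjective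
  rw [← maximalIdeal_height_eq_ringKrullDim]
  have hmap : maximalIdeal (R ⧸ p) = (maximalIdeal R).map (Ideal.Quotient.mk p) :=
    (map_maximalIdeal_of_surjective _ Ideal.Quotient.mk_surjective).symm
  have hmin : maximalIdeal (R ⧸ p) ∈
      ((Ideal.ofList rs).map (Ideal.Quotient.mk p)).minimalPrimes := by
    refine ⟨⟨inferInstance, ?_⟩, fun Q ⟨hQ, hle⟩ _ ↦ ?_⟩
    · rw [hmap]
      exact Ideal.map_mono (Ideal.span_le.mpr hrs)
    · rw [hmap, Ideal.map_le_iff_le_comap]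
      have := hQ.comap (Ideal.Quotient.mk p)
      refine h.trans (this.radical_le_iff.mpr (sup_le (fun r hr ↦ ?_)
        (Ideal.map_le_iff_le_comap.mp hle)))
      simp [Ideal.mem_comap, Ideal.Quotient.eq_zero_iff_mem.mpr hr]
  classical
  have hs : (Ideal.ofList rs).map (Ideal.Quotient.mk p) =
      Ideal.span ((rs.map (Ideal.Quotient.mk p)).toFinset : Set (R ⧸ p)) := by
    rw [Ideal.map_ofList]
    simp [Ideal.ofList]
  rw [hs] at hmin
  have h1 := Ideal.height_le_card_of_mem_minimalPrimes_span_finset hmin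
  have h2 : (rs.map (Ideal.Quotient.mk p)).toFinset.card ≤ rs.length :=
    (List.toFinset_card_le _).trans (by simp)
  exact_mod_cast h1.trans (by exact_mod_cast h2)

/-- For an `M`-regular element `x`, the vanishing of `Ext N M i` and `Ext N M (i + 1)` implies
the vanishing of `Ext N (M ⧸ x M) i`. -/
lemma IsSMulRegular.subsingleton_ext_quotSMulTop {R : Type u} [CommRing R]
    {M : ModuleCat.{u} R} {x : R} (hx : IsSMulRegular M x) (N : ModuleCat.{u} R) (i : ℕ)
    (h₁ : Subsingleton (Ext N M i)) (h₂ : Subsingleton (Ext N M (i + 1))) :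
    Subsingleton (Ext N (ModuleCat.of R (QuotSMulTop x M)) i) := by
  refine subsingleton_of_forall_eq 0 fun e ↦ ?_
  have he : e.comp hx.smulShortComplex_shortExact.extClass rfl = 0 :=
    h₂.elim _ _
  obtain ⟨e', rfl⟩ := Ext.covariant_sequence_exact₃ N hx.smulShortComplex_shortExact e rfl he
  obtain rfl : e' = 0 := h₁.elim _ _
  simp only [Ext.zero_comp]
  rfl

/-- If an `M`-regular element `x` annihilates `N` and `Ext N M i` vanishes, then the connecting
map `Ext N (M ⧸ x M) i → Ext N M (i + 1)` is an isomorphism. -/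
lemma IsSMulRegular.nonempty_ext_quotSMulTop_linearEquiv {R : Type u} [CommRing R]
    {M : ModuleCat.{u} R} {x : R} (hx : IsSMulRegular M x) (N : ModuleCat.{u} R)
    (hxN : x ∈ Module.annihilator R N) (i : ℕ) (h : Subsingleton (Ext N M i)) :
    Nonempty (Ext N (ModuleCat.of R (QuotSMulTop x M)) i ≃ₗ[R] Ext N M (i + 1)) := by
  let δ : Ext N (ModuleCat.of R (QuotSMulTop x M)) i →ₗ[R] Ext N M (i + 1) :=
    hx.smulShortComplex_shortExact.extClass.postcompOfLinear R N rfl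
  refine ⟨LinearEquiv.ofBijective δ ⟨?_, fun z ↦ ?_⟩⟩
  · rw [← LinearMap.ker_eq_bot, LinearMap.ker_eq_bot']
    intro z hz
    obtain ⟨z', rfl⟩ := Ext.covariant_sequence_exact₃ N hx.smulShortComplex_shortExact z rfl hz
    obtain rfl : z' = 0 := h.elim _ _
    simp only [Ext.zero_comp]
    rfl
  · refine Ext.covariant_sequence_exact₁ N hx.smulShortComplex_shortExact z ?_ rfl
    have hzero : x • 𝟙 N = 0 := by
      rw [← ModuleCat.lsmul_eq_smul_id, Module.mem_annihilator_iff_lsmul_eq_zero.mp hxN]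
      rfl
    calc z.comp (Ext.mk₀ (x • 𝟙 M)) (add_zero _) = x • z := (Ext.smul_eq_comp_mk₀ z x).symm
      _ = (Ext.mk₀ (x • 𝟙 N)).comp z (zero_add _) := by simp [Ext.mk₀_smul]
      _ = 0 := by simp [hzero]

/-- Over a Noetherian local ring with residue field `k`, if `Ext k M i` vanishes for all
`i < n`, then every sequence of `n` elements of the maximal ideal that generates, modulo the
annihilator of `M`, an ideal primary to the maximal ideal is weakly `M`-regular. -/
lemma ModuleCat.isWeaklyRegular_of_subsingleton_ext (M : ModuleCat.{u} R) [Module.Finite R M]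
    [Nontrivial M] (rs : List R) (hrs : ∀ r ∈ rs, r ∈ maximalIdeal R)
    (hrad : maximalIdeal R ≤ (Module.annihilator R M ⊔ Ideal.ofList rs).radical)
    (hext : ∀ i < rs.length, Subsingleton (Ext (ModuleCat.of R (ResidueField R)) M i)) :
    IsWeaklyRegular M rs := by
  induction rs generalizing M with
  | nil => exact IsWeaklyRegular.nil R M
  | cons x rs ih =>
    simp only [List.mem_cons, forall_eq_or_imp] at hrs
    have hsmul : maximalIdeal R • (⊤ : Submodule R M) < ⊤ :=
      (Submodule.top_ne_ideal_smul_of_le_jacobson_annihilator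
        (maximalIdeal_le_jacobson _)).symm.lt_top
    have hsupp : Module.support R (ModuleCat.of R (ResidueField R)) =
        PrimeSpectrum.zeroLocus (maximalIdeal R) := by
      change Module.support R (R ⧸ maximalIdeal R) = _
      rw [Module.support_eq_zeroLocus, Ideal.annihilator_quotient]
    have hfin : Module.Finite R (ModuleCat.of R (ResidueField R)) :=
      inferInstanceAs (Module.Finite R (R ⧸ maximalIdeal R))
    obtain ⟨ts, hlen, -, hts⟩ := ModuleCat.exists_isRegular_of_exists_subsingleton_ext
      (maximalIdeal R) _ M hsmul _ hsupp hext
    have hx : IsSMulRegular M x := by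
      by_contra hx
      have : x ∈ ⋃ p ∈ associatedPrimes R M, (p : Set R) := by
        rw [biUnion_associatedPrimes_eq_compl_regular]
        exact hx
      simp only [Set.mem_iUnion, SetLike.mem_coe] at this
      obtain ⟨p, hp, hxp⟩ := this
      have : p.IsPrime := IsAssociatedPrime.isPrime hp
      have h1 := hts.length_le_ringKrullDim_quotient hp
      have h2 : ringKrullDim (R ⧸ p) ≤ rs.length := by
        refine ringKrullDim_quotient_le_length_of_le_radical rs
          (hrad.trans (Ideal.radical_mono ?_)) hrs.2
        rw [Ideal.ofList_cons, ← sup_assoc]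
        refine sup_le_sup_right (sup_le ?_ ?_) _
        · exact Submodule.annihilator_top.ge.trans <| IsAssociatedPrime.annihilator_le hp
        · rwa [Ideal.span_singleton_le_iff_mem]
      rw [hlen] at h1
      have h3 : (((x :: rs).length : ℕ) : WithBot ℕ∞) ≤ (rs.length : ℕ) := h1.trans h2
      have h4 : (x :: rs).length ≤ rs.length := by exact_mod_cast h3
      simp at h4
    refine (isWeaklyRegular_cons_iff M x rs).mpr ⟨hx, ?_⟩
    have : Nontrivial (QuotSMulTop x M) := nontrivial_quotSMulTop_of_mem_maximalIdeal M hrs.1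
    refine ih (ModuleCat.of R (QuotSMulTop x M)) hrs.2 (hrad.trans (Ideal.radical_mono ?_)) ?_
    · rw [Ideal.ofList_cons, ← sup_assoc]
      refine sup_le_sup_right (sup_le ?_ ?_) _
      · exact LinearMap.annihilator_le_of_surjective _ (Submodule.mkQ_surjective _)
      · rw [Ideal.span_singleton_le_iff_mem, Module.mem_annihilator]
        intro z
        induction z using Submodule.Quotient.induction_on with | _ n
        exact (Submodule.Quotient.mk_eq_zero _).mpr
          (Submodule.smul_mem_pointwise_smul _ _ _ trivial)
    · exact fun i hi ↦ hx.subsingleton_ext_quotSMulTop _ i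
        (hext i (hi.trans (by simp))) (hext (i + 1) (by simpa using hi))

/-- If `rs` is an `M`-regular sequence of elements annihilating `N`, then
`Ext N M rs.length` is isomorphic to `Hom(N, M ⧸ rs M)`. -/
lemma ModuleCat.nonempty_ext_linearEquiv_hom (N M : ModuleCat.{u} R) [Module.Finite R N]
    [Nontrivial N] [Module.Finite R M] (rs : List R)
    (hrs : ∀ r ∈ rs, r ∈ Module.annihilator R N) (reg : IsRegular M rs) :
    Nonempty (Ext N M rs.length ≃ₗ[R] (N →ₗ[R] M ⧸ Ideal.ofList rs • (⊤ : Submodule R M))) := by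
  induction rs generalizing M with
  | nil =>
    have h : Ideal.ofList ([] : List R) • (⊤ : Submodule R M) = ⊥ := by simp
    exact ⟨(Ext.linearEquiv₀ (R := R)).trans (ModuleCat.homLinearEquiv.trans
      (LinearEquiv.congrRight (Submodule.quotEquivOfEqBot _ h).symm))⟩
  | cons x rs ih =>
    have : Nontrivial M := reg.nontrivial
    obtain ⟨hx, hreg⟩ := (isRegular_cons_iff M x rs).mp reg
    obtain ⟨e⟩ := ih (ModuleCat.of R (QuotSMulTop x M)) (fun r hr ↦ hrs r (by simp [hr])) hreg
    have hsmul : Module.annihilator R N • (⊤ : Submodule R M) < ⊤ := by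
      refine (Submodule.top_ne_ideal_smul_of_le_jacobson_annihilator ?_).symm.lt_top
      refine le_trans (le_maximalIdeal ?_) (maximalIdeal_le_jacobson _)
      rwa [ne_eq, Module.annihilator_eq_top_iff, not_subsingleton_iff_nontrivial]
    have hsub : Subsingleton (Ext N M rs.length) :=
      ModuleCat.subsingleton_ext_of_exists_isRegular (Module.annihilator R N) N
        Module.support_eq_zeroLocus.le M hsmul _ hrs reg _ (by simp)
    obtain ⟨f⟩ := hx.nonempty_ext_quotSMulTop_linearEquiv N (hrs x (by simp)) _ hsub
    exact ⟨f.symm.trans (e.trans (LinearEquiv.congrRight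
      (Submodule.quotOfListConsSMulTopEquivQuotSMulTopInner M x rs).symm))⟩

/-- If `rs` is an `R`-regular sequence contained in a proper ideal `a`, then
`Ext (R ⧸ a) R rs.length` is isomorphic to `Hom(R ⧸ a, R ⧸ (rs))`. -/
lemma nonempty_ext_quotient_linearEquiv_hom {a : Ideal R} (ha : a ≠ ⊤) (rs : List R)
    (hrs : ∀ r ∈ rs, r ∈ a) (reg : IsRegular R rs) :
    Nonempty (Ext (ModuleCat.of R (R ⧸ a)) (ModuleCat.of R R) rs.length ≃ₗ[R]
      ((R ⧸ a) →ₗ[R] R ⧸ Ideal.ofList rs)) := by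
  have : Nontrivial (R ⧸ a) := Ideal.Quotient.nontrivial_iff.mpr ha
  obtain ⟨e⟩ := ModuleCat.nonempty_ext_linearEquiv_hom (ModuleCat.of R (R ⧸ a))
    (ModuleCat.of R R) rs (by simpa [Ideal.annihilator_quotient] using hrs) reg
  exact ⟨e.trans (LinearEquiv.congrRight (Submodule.quotEquivOfEq _ _ (by simp)))⟩

end Depth

/-- Evaluation at `1` is an isomorphism from the endomorphisms of `R ⧸ a` to `R ⧸ a`. -/
noncomputable def Ideal.quotientEndEquiv {R : Type*} [CommRing R] (a : Ideal R) :
    ((R ⧸ a) →ₗ[R] (R ⧸ a)) ≃ₗ[R] (R ⧸ a) :=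
  LinearEquiv.ofBijective (LinearMap.applyₗ 1) <| by
    refine ⟨fun f g h ↦ ?_, fun y ↦ ⟨LinearMap.mulLeft R y, by simp⟩⟩
    refine Submodule.linearMap_qext _ (LinearMap.ext_ring ?_)
    exact h

/-- In a Cohen–Macaulay local ring, every parameter ideal is generated by a regular sequence
whose length is the dimension of the ring. -/
lemma IsParameterIdeal.exists_isRegular {R : Type*} [CommRing R] [IsNoetherianRing R]
    [IsLocalRing R] (hCM : IsCohenMacaulayLocalRing R) {a : Ideal R} (ha : IsParameterIdeal R a) :
    ∃ rs : List R, ringKrullDim R = rs.length ∧ RingTheory.Sequence.IsRegular R rs ∧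
      a = Ideal.ofList rs := by
  obtain ⟨d, x, hd, hx, rfl, hrad⟩ := ha
  have hspan : Ideal.span (Set.range x) = Ideal.ofList (List.ofFn x) := by
    simp only [Ideal.ofList, List.mem_ofFn']
    rfl
  have hxm : ∀ r ∈ List.ofFn x, r ∈ maximalIdeal R := by
    simpa [List.mem_ofFn'] using hx
  have hdepth : ringDepth R = d := by
    unfold IsCohenMacaulayLocalRing at hCM
    rw [hd] at hCM
    exact_mod_cast hCM
  obtain ⟨ts, htlen, htm, ht⟩ : ∃ ts : List R, ts.length = d ∧
      (∀ r ∈ ts, r ∈ maximalIdeal R) ∧ RingTheory.Sequence.IsRegular R ts := by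
    unfold ringDepth at hdepth
    have hne : Nonempty {n : ℕ∞ | ∃ (k : ℕ) (a : Fin k → R), (k : ℕ∞) = n ∧
        (∀ i, a i ∈ maximalIdeal R) ∧ RingTheory.Sequence.IsRegular R (List.ofFn a)} :=
      ⟨0, 0, Fin.elim0, by simp, by simp, by simpa using RingTheory.Sequence.IsRegular.nil R R⟩
    have hmem := ENat.sSup_mem_of_nonempty_of_lt_top (hdepth ▸ ENat.natCast_lt_top d)
    rw [hdepth] at hmem
    obtain ⟨k, t, hk, htm, ht⟩ := hmem
    refine ⟨List.ofFn t, ?_, by simpa [List.mem_ofFn'] using htm, ht⟩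
    simpa using hk
  have hsmul : maximalIdeal R • (⊤ : Submodule R R) < ⊤ :=
    (Submodule.top_ne_ideal_smul_of_le_jacobson_annihilator
      (maximalIdeal_le_jacobson _)).symm.lt_top
  have hfin : Module.Finite R (ModuleCat.of R (ResidueField R)) :=
    inferInstanceAs (Module.Finite R (R ⧸ maximalIdeal R))
  have hext := ModuleCat.subsingleton_ext_of_exists_isRegular (maximalIdeal R)
    (ModuleCat.of R (ResidueField R)) (by
      change Module.support R (R ⧸ maximalIdeal R) ⊆ _
      rw [Module.support_eq_zeroLocus, Ideal.annihilator_quotient])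
    (ModuleCat.of R R) hsmul ts htm ht
  refine ⟨List.ofFn x, by simpa using hd, .of_isWeaklyRegular_of_mem_maximalIdeal R hxm ?_, hspan⟩
  refine ModuleCat.isWeaklyRegular_of_subsingleton_ext (ModuleCat.of R R) _ hxm ?_ ?_
  · rw [← hrad, hspan]
    exact Ideal.radical_mono le_sup_right
  · simpa [htlen] using hext

theorem hom_quotient_iso_of_isCohenMacaulay (R : Type*) [CommRing R] [IsNoetherianRing R] [IsLocalRing R]
    (hCM : IsCohenMacaulayLocalRing R) (a b : Ideal R) (ha : IsParameterIdeal R a)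
    (hb : IsParameterIdeal R b) (hba : b ≤ a) :
    Nonempty (((R ⧸ a) →ₗ[R] (R ⧸ b)) ≃ₗ[R] (R ⧸ a)) := by
  have ha_top : a ≠ ⊤ := by
    obtain ⟨-, -, -, -, -, hrad⟩ := ha
    rintro rfl
    exact Ideal.IsPrime.ne_top' (hrad.symm.trans (Ideal.radical_top R))
  obtain ⟨rs, hrs, hrs_reg, hrs_span⟩ := ha.exists_isRegular hCM
  obtain ⟨ts, hts, hts_reg, hts_span⟩ := hb.exists_isRegular hCM
  have hlen : rs.length = ts.length := by exact_mod_cast hrs.symm.trans hts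
  obtain ⟨e⟩ := nonempty_ext_quotient_linearEquiv_hom ha_top rs
    (fun r hr ↦ hrs_span ▸ Ideal.subset_span hr) hrs_reg
  obtain ⟨f⟩ := nonempty_ext_quotient_linearEquiv_hom ha_top ts
    (fun r hr ↦ hba (hts_span ▸ Ideal.subset_span hr)) hts_reg
  rw [← hrs_span, hlen] at e
  rw [← hts_span] at f
  exact ⟨f.symm.trans (e.trans a.quotientEndEquiv)⟩
end

section
/- Let (R, m) be a commutative Noetherian local ring. Suppose that for any parameter ideals a and b of R with b ⊆ a, the R-module Hom_R(R/a, R/b) is isomorphic to R/a. Then R is a Cohen-Macaulay ring. -/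
open IsLocalRing

/-- If `Hom(R/I, R/J)` is cyclic as an `R`-module, then so is `(J : I) / J`. -/
lemma exists_colon_generator_of_hom_quotient_equiv {R : Type*} [CommRing R] {I J : Ideal R}
    (e : ((R ⧸ I) →ₗ[R] (R ⧸ J)) ≃ₗ[R] (R ⧸ I)) :
    ∃ z : R, (∀ c ∈ I, z * c ∈ J) ∧ ∀ r : R, (∀ c ∈ I, r * c ∈ J) → ∃ t, r - t * z ∈ J := by
  obtain ⟨z, hz⟩ := Ideal.Quotient.mk_surjective (e.symm 1 1)
  refine ⟨z, fun c hc ↦ ?_, fun r hr ↦ ?_⟩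
  · rw [← Ideal.Quotient.eq_zero_iff_mem, mul_comm, map_mul, hz]
    have h1 : (c • (1 : R ⧸ I)) = 0 := by
      rw [Algebra.smul_def, mul_one]
      exact Ideal.Quotient.eq_zero_iff_mem.mpr hc
    have h2 := (e.symm 1).map_smul c 1
    rw [h1, map_zero, Algebra.smul_def] at h2
    exact h2.symm
  · let ψ : (R ⧸ I) →ₗ[R] (R ⧸ J) :=
      Submodule.liftQ I (LinearMap.toSpanSingleton R (R ⧸ J) (Ideal.Quotient.mk J r)) (by
        intro c hc
        rw [LinearMap.mem_ker, LinearMap.toSpanSingleton_apply, Algebra.smul_def]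
        change Ideal.Quotient.mk J c * Ideal.Quotient.mk J r = 0
        rw [← map_mul, Ideal.Quotient.eq_zero_iff_mem, mul_comm]
        exact hr c hc)
    have hψ : ψ 1 = Ideal.Quotient.mk J r := by
      change Submodule.liftQ I _ _ (Submodule.Quotient.mk (1 : R)) = _
      rw [Submodule.liftQ_apply, LinearMap.toSpanSingleton_apply, one_smul]
    obtain ⟨t, ht⟩ := Ideal.Quotient.mk_surjective (e ψ)
    refine ⟨t, ?_⟩
    have h1 : e ψ = t • 1 := by
      rw [← ht, Algebra.smul_def, mul_one]; rfl
    have h2 : ψ = t • e.symm 1 := by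
      rw [← map_smul, ← h1, e.symm_apply_apply]
    rw [← Ideal.Quotient.mk_eq_mk_iff_sub_mem, ← hψ, h2, LinearMap.smul_apply, ← hz, map_mul,
      Algebra.smul_def]
    rfl

lemma mem_sup_span_pow_of_hom_quotient_equiv {R : Type*} [CommRing R] [IsLocalRing R]
    {J : Ideal R} {x y : R} {n : ℕ} (hn : n ≠ 0) (hx : x ∈ maximalIdeal R) (hxJ : x ∉ J.radical)
    (hxy : x * y ∈ J)
    (e : ((R ⧸ (Ideal.span {x ^ n} ⊔ J)) →ₗ[R] (R ⧸ (Ideal.span {x ^ (2 * n)} ⊔ J))) ≃ₗ[R]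
      (R ⧸ (Ideal.span {x ^ n} ⊔ J))) :
    y ∈ J ⊔ Ideal.span {x ^ n} := by
  obtain ⟨z, hz, hgen⟩ := exists_colon_generator_of_hom_quotient_equiv e
  have hmem (N : ℕ) (r : R) : r ∈ Ideal.span {x ^ N} ⊔ J ↔ ∃ c, r - c * x ^ N ∈ J := by
    rw [Ideal.mem_span_singleton_sup]
    constructor
    · rintro ⟨c, b, hb, rfl⟩
      exact ⟨c, by simpa using hb⟩
    · rintro ⟨c, hc⟩
      exact ⟨c, _, hc, by ring⟩
  obtain ⟨c, hc⟩ := (hmem _ _).mp (hz (x ^ n) ((hmem _ _).mpr ⟨1, by simp⟩))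
  have hy : ∀ c ∈ Ideal.span {x ^ n} ⊔ J, y * c ∈ Ideal.span {x ^ (2 * n)} ⊔ J := by
    intro w hw
    obtain ⟨v, hv⟩ := (hmem _ _).mp hw
    refine Ideal.mem_sup_right ?_
    obtain ⟨k, rfl⟩ := Nat.exists_eq_succ_of_ne_zero hn
    have := J.add_mem (J.mul_mem_left y hv) (J.mul_mem_left (v * x ^ k) hxy)
    convert this using 1
    simp only [Nat.succ_eq_add_one]
    ring
  have hp : ∀ c ∈ Ideal.span {x ^ n} ⊔ J, x ^ n * c ∈ Ideal.span {x ^ (2 * n)} ⊔ J := by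
    intro w hw
    obtain ⟨v, hv⟩ := (hmem _ _).mp hw
    refine (hmem _ _).mpr ⟨v, ?_⟩
    convert J.mul_mem_left (x ^ n) hv using 1
    ring
  obtain ⟨t, ht⟩ := hgen y hy
  obtain ⟨s, hs⟩ := hgen (x ^ n) hp
  obtain ⟨p, hp⟩ := (hmem _ _).mp ht
  obtain ⟨q, hq⟩ := (hmem _ _).mp hs
  by_cases hsu : IsUnit s
  · obtain ⟨s', hs'⟩ := hsu.exists_left_inv
    rw [sup_comm]
    refine (hmem _ _).mpr ⟨p * x ^ n + t * s' * (1 - q * x ^ n), ?_⟩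
    convert J.sub_mem hp (J.mul_mem_left (t * s') hq) using 1
    linear_combination (-t * z) * hs'
  · exfalso
    have hxn : x ^ n ∈ maximalIdeal R := Ideal.pow_mem_of_mem _ hx n (Nat.pos_of_ne_zero hn)
    have hunit : IsUnit (1 - (s * c + q * x ^ n)) := by
      refine (isUnit_or_isUnit_one_sub_self _).resolve_left ?_
      exact (mem_maximalIdeal _).mp ((maximalIdeal R).add_mem
        ((maximalIdeal R).mul_mem_right c hsu) ((maximalIdeal R).mul_mem_left q hxn))
    obtain ⟨w, hw⟩ := hunit.exists_left_inv
    refine hxJ ⟨2 * n, ?_⟩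
    convert J.mul_mem_left w (J.add_mem (J.mul_mem_left (x ^ n) hq) (J.mul_mem_left s hc)) using 1
    linear_combination (-x ^ (2 * n)) * hw

lemma Ideal.mem_of_forall_mem_sup_pow {R : Type*} [CommRing R] [IsNoetherianRing R]
    [IsLocalRing R] {I K : Ideal R} (hK : K ≠ ⊤) {y : R} (h : ∀ n, y ∈ I ⊔ K ^ n) : y ∈ I := by
  rw [← Ideal.Quotient.eq_zero_iff_mem]
  have h0 := Ideal.iInf_pow_smul_eq_bot_of_isLocalRing (M := R ⧸ I) K hK
  rw [← Submodule.mem_bot R, ← h0, Submodule.mem_iInf]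
  intro n
  obtain ⟨a, ha, b, hb, rfl⟩ := Submodule.mem_sup.mp (h n)
  rw [map_add, Ideal.Quotient.eq_zero_iff_mem.mpr ha, zero_add]
  have := Submodule.smul_mem_smul hb (Submodule.mem_top (x := (1 : R ⧸ I)))
  rwa [Algebra.smul_def, mul_one] at this

lemma Ideal.radical_span_range_pow {R ι : Type*} [CommRing R] (a : ι → R) {N : ι → ℕ}
    (hN : ∀ i, N i ≠ 0) :
    (Ideal.span (Set.range fun i ↦ a i ^ N i)).radical = (Ideal.span (Set.range a)).radical := by
  apply le_antisymm
  · refine Ideal.radical_mono (Ideal.span_le.mpr ?_)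
    rintro _ ⟨i, rfl⟩
    exact Ideal.pow_mem_of_mem _ (Ideal.subset_span (Set.mem_range_self i)) _
      (Nat.pos_of_ne_zero (hN i))
  · refine Ideal.radical_le_radical_iff.mpr (Ideal.span_le.mpr ?_)
    rintro _ ⟨i, rfl⟩
    exact Ideal.mem_radical_iff.mpr ⟨N i, Ideal.subset_span ⟨i, rfl⟩⟩

/-- No member of a system of parameters lies in the radical of the ideal generated by the others. -/
lemma notMem_radical_span_image_compl {R : Type*} [CommRing R] [IsNoetherianRing R]
    [IsLocalRing R] {d : ℕ} (hd : ringKrullDim R = d) {a : Fin d → R}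
    (hr : (Ideal.span (Set.range a)).radical = maximalIdeal R) (i : Fin d) :
    a i ∉ (Ideal.span (a '' {i}ᶜ)).radical := by
  intro hi
  have hrad : (Ideal.span (a '' {i}ᶜ)).radical = maximalIdeal R := by
    refine le_antisymm (hr ▸ Ideal.radical_mono (Ideal.span_mono (Set.image_subset_range _ _))) ?_
    rw [← hr]
    refine Ideal.radical_le_radical_iff.mpr (Ideal.span_le.mpr ?_)
    rintro _ ⟨j, rfl⟩
    by_cases hj : j = i
    · exact hj ▸ hi
    · exact Ideal.le_radical (Ideal.subset_span ⟨j, hj, rfl⟩)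
  have hmin : maximalIdeal R ∈ (Ideal.span (a '' {i}ᶜ)).minimalPrimes := by
    rw [← Ideal.radical_minimalPrimes, hrad, Ideal.minimalPrimes_eq_subsingleton_self]
    rfl
  have h1 := Ideal.height_le_card_of_mem_minimalPrimes_span (Set.toFinite _) hmin
  have h2 : (a '' {i}ᶜ).ncard ≤ d - 1 := by
    refine (Set.ncard_image_le (Set.toFinite _)).trans ?_
    rw [Set.ncard_compl]
    simp
  have h3 : (maximalIdeal R).height = d := by
    have := maximalIdeal_height_eq_ringKrullDim (R := R)
    rw [hd] at this
    exact_mod_cast this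
  rw [h3] at h1
  have h4 : d ≤ (a '' {i}ᶜ).ncard := by exact_mod_cast h1
  have := i.pos
  omega

lemma exists_systemOfParameters (R : Type*) [CommRing R] [IsNoetherianRing R] [IsLocalRing R] :
    ∃ (d : ℕ) (a : Fin d → R), ringKrullDim R = d ∧ (∀ i, a i ∈ maximalIdeal R) ∧
      (Ideal.span (Set.range a)).radical = maximalIdeal R := by
  obtain ⟨s, hs, hcard⟩ := (maximalIdeal R).exists_finset_card_eq_height_of_isNoetherianRing
  have hrange : Set.range (fun i ↦ (s.equivFin.symm i : R)) = s := by
    ext x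
    constructor
    · rintro ⟨i, rfl⟩
      exact (s.equivFin.symm i).2
    · intro hx
      exact ⟨s.equivFin ⟨x, hx⟩, by simp⟩
  refine ⟨s.card, fun i ↦ s.equivFin.symm i, ?_, fun i ↦ ?_, ?_⟩
  · rw [← maximalIdeal_height_eq_ringKrullDim, ← hcard]
    rfl
  · exact hs.1.2 (Ideal.subset_span (s.equivFin.symm i).2)
  · rw [hrange]
    refine le_antisymm (hs.1.1.radical_le_iff.mpr hs.1.2) ?_
    rw [Ideal.radical_eq_sInf]
    refine le_sInf fun p ⟨hp, hprime⟩ ↦ ?_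
    exact hs.2 ⟨hprime, hp⟩ (le_maximalIdeal hprime.ne_top)

/-- In a ring satisfying the cyclicity hypothesis on parameter ideals, each member of a system of
parameters is regular modulo the ideal generated by the others. -/
lemma mem_span_image_compl_of_mul_mem {R : Type*} [CommRing R] [IsNoetherianRing R]
    [IsLocalRing R]
    (h : ∀ a b : Ideal R, IsParameterIdeal R a → IsParameterIdeal R b → b ≤ a →
      Nonempty (((R ⧸ a) →ₗ[R] (R ⧸ b)) ≃ₗ[R] (R ⧸ a)))
    {d : ℕ} (hd : ringKrullDim R = d) {a : Fin d → R} (ha : ∀ i, a i ∈ maximalIdeal R)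
    (hr : (Ideal.span (Set.range a)).radical = maximalIdeal R) (i : Fin d) {y : R}
    (hy : a i * y ∈ Ideal.span (a '' {i}ᶜ)) : y ∈ Ideal.span (a '' {i}ᶜ) := by
  have hpar {N : ℕ} (hN : N ≠ 0) :
      IsParameterIdeal R (Ideal.span {a i ^ N} ⊔ Ideal.span (a '' {i}ᶜ)) := by
    have hE (j : Fin d) : Function.update (fun _ ↦ 1) i N j ≠ 0 := by
      by_cases hj : j = i
      · subst hj; simpa using hN
      · simp [hj]
    refine ⟨d, fun j ↦ a j ^ Function.update (fun _ ↦ 1) i N j, hd,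
      fun j ↦ Ideal.pow_mem_of_mem _ (ha j) _ (Nat.pos_of_ne_zero (hE j)), ?_, ?_⟩
    on_goal 2 => rw [← hr, ← Ideal.radical_span_range_pow a hE]; congr 1
    all_goals
      rw [← Ideal.span_union]
      congr 1
      ext x
      constructor
      · rintro (rfl | ⟨j, hj, rfl⟩)
        · exact ⟨i, by simp⟩
        · exact ⟨j, by simp [show j ≠ i from hj]⟩
      · rintro ⟨j, rfl⟩
        by_cases hj : j = i
        · subst hj
          left
          simp
        · right
          exact ⟨j, hj, by simp [hj]⟩
  refine Ideal.mem_of_forall_mem_sup_pow (K := Ideal.span {a i}) ?_ fun n ↦ ?_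
  · refine ne_top_of_le_ne_top (maximalIdeal.isMaximal R).ne_top ?_
    exact (Ideal.span_singleton_le_iff_mem _).mpr (ha i)
  · rw [Ideal.span_singleton_pow]
    rcases eq_or_ne n 0 with rfl | hn
    · simp
    · obtain ⟨e⟩ := h _ _ (hpar hn) (hpar (N := 2 * n) (by omega)) (sup_le_sup_right
        (Ideal.span_singleton_le_span_singleton.mpr (pow_dvd_pow _ (by omega))) _)
      exact mem_sup_span_pow_of_hom_quotient_equiv hn (ha i)
        (notMem_radical_span_image_compl hd hr i) hy e

lemma mem_span_image_Iio_of_mul_mem {R : Type*} [CommRing R] [IsNoetherianRing R]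
    [IsLocalRing R]
    (h : ∀ a b : Ideal R, IsParameterIdeal R a → IsParameterIdeal R b → b ≤ a →
      Nonempty (((R ⧸ a) →ₗ[R] (R ⧸ b)) ≃ₗ[R] (R ⧸ a)))
    {d : ℕ} (hd : ringKrullDim R = d) {a : Fin d → R} (ha : ∀ i, a i ∈ maximalIdeal R)
    (hr : (Ideal.span (Set.range a)).radical = maximalIdeal R) (i : Fin d) {y : R}
    (hy : a i * y ∈ Ideal.span (a '' Set.Iio i)) : y ∈ Ideal.span (a '' Set.Iio i) := by
  refine Ideal.mem_of_forall_mem_sup_pow (maximalIdeal.isMaximal R).ne_top fun n ↦ ?_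
  let E (j : Fin d) : ℕ := if j ≤ i then 1 else n + 1
  have hE (j : Fin d) : E j ≠ 0 := by
    unfold E; split_ifs <;> simp
  have hlow {j : Fin d} (hj : j ≤ i) : a j ^ E j = a j := by simp [E, hj]
  have key := mem_span_image_compl_of_mul_mem h hd (a := fun j ↦ a j ^ E j)
    (fun j ↦ Ideal.pow_mem_of_mem _ (ha j) _ (Nat.pos_of_ne_zero (hE j)))
    ((Ideal.radical_span_range_pow a hE).trans hr) i (y := y) (by
      simp only [hlow le_rfl]
      refine Ideal.span_mono ?_ hy
      rintro _ ⟨j, hj, rfl⟩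
      exact ⟨j, ne_of_lt hj, hlow (le_of_lt hj)⟩)
  refine Ideal.span_le.mpr ?_ key
  rintro _ ⟨j, hj, rfl⟩
  rcases lt_or_ge j i with hji | hji
  · simp only [hlow hji.le]
    exact Ideal.mem_sup_left (Ideal.subset_span ⟨j, hji, rfl⟩)
  · have hij : ¬ j ≤ i := fun h' ↦ hj (le_antisymm h' hji)
    simp only [E, hij, if_false]
    exact Ideal.mem_sup_right
      (Ideal.pow_le_pow_right (Nat.le_succ n) (Ideal.pow_mem_pow (ha j) _))

theorem isCohenMacaulay_of_hom_quotient_iso (R : Type*) [CommRing R] [IsNoetherianRing R] [IsLocalRing R]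
    (h : ∀ a b : Ideal R, IsParameterIdeal R a → IsParameterIdeal R b → b ≤ a →
      Nonempty (((R ⧸ a) →ₗ[R] (R ⧸ b)) ≃ₗ[R] (R ⧸ a))) :
    IsCohenMacaulayLocalRing R := by
  obtain ⟨d, a, hd, ha, hr⟩ := exists_systemOfParameters R
  have hreg : RingTheory.Sequence.IsRegular R (List.ofFn a) := by
    refine ⟨⟨fun i hi ↦ ?_⟩, ?_⟩
    · have hi' : i < d := by simpa using hi
      have htake : Ideal.ofList ((List.ofFn a).take i) • (⊤ : Submodule R R) =
          Ideal.span (a '' Set.Iio ⟨i, hi'⟩) := by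
        rw [smul_eq_mul, Ideal.mul_top, Ideal.ofList]
        congr 1
        ext x
        simp only [Set.mem_ofPred_eq, List.mem_take_iff_getElem, List.getElem_ofFn,
          List.length_ofFn, Set.mem_image, Set.mem_Iio]
        constructor
        · rintro ⟨j, hj, rfl⟩
          exact ⟨⟨j, by omega⟩, by simp only [Fin.mk_lt_mk]; omega, rfl⟩
        · rintro ⟨j, hj, rfl⟩
          exact ⟨j, lt_min hj j.2, rfl⟩
      rw [htake, List.getElem_ofFn, isSMulRegular_iff_right_eq_zero_of_smul]
      intro m hm
      obtain ⟨y, rfl⟩ := Ideal.Quotient.mk_surjective m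
      rw [Algebra.smul_def] at hm
      refine Ideal.Quotient.eq_zero_iff_mem.mpr (mem_span_image_Iio_of_mul_mem h hd ha hr _ ?_)
      rw [← Ideal.Quotient.eq_zero_iff_mem, map_mul]
      exact hm
    · rw [smul_eq_mul, Ideal.mul_top]
      refine (ne_top_of_le_ne_top (maximalIdeal.isMaximal R).ne_top (Ideal.span_le.mpr ?_)).symm
      intro x hx
      obtain ⟨i, rfl⟩ := List.mem_ofFn.mp hx
      exact ha i
  have hdepth : ringDepth R = d := by
    refine le_antisymm (sSup_le ?_) (le_sSup ⟨d, a, rfl, ha, hreg⟩)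
    rintro _ ⟨k, b, rfl, hb, hbreg⟩
    have hdim := ringKrullDim_add_length_eq_ringKrullDim_of_isRegular _ hbreg
    have hne : Nontrivial (R ⧸ Ideal.ofList (List.ofFn b)) := by
      refine Ideal.Quotient.nontrivial_iff.mpr fun htop ↦ hbreg.top_ne_smul ?_
      rw [htop, smul_eq_mul, Ideal.mul_top]
    have hle : (k : WithBot ℕ∞) ≤ d := by
      rw [← hd, ← hdim, List.length_ofFn]
      exact le_add_of_nonneg_left ringKrullDim_nonneg_of_nontrivial
    exact_mod_cast hle
  rw [IsCohenMacaulayLocalRing, hdepth, hd]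
  rfl
end

section
/- Let (R, m) be a commutative Noetherian local ring. Then R is Cohen-Macaulay if and only if for any parameter ideals a and b of R with b ⊆ a, the R-module Hom_R(R/a, R/b) is isomorphic to R/a. -/
open IsLocalRing

open RingTheory.Sequence Module
open scoped Pointwise

universe u v

section Exchange

variable {R : Type u} [CommRing R] {N : Type v} [AddCommGroup N] [Module R N]

/-- If `x` and `y` are regular on `M` and `y` kills `N`, then multiplication by `x` identifies
`Hom(N, M/yM)` with `Hom(N, M/xyM)`. -/
theorem nonempty_linearMap_quotSMulTop_mul_equiv {M : Type u} [AddCommGroup M] [Module R M]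
    {x y : R} (hx : IsSMulRegular M x) (hy : IsSMulRegular M y) (hyN : y ∈ annihilator R N) :
    Nonempty ((N →ₗ[R] QuotSMulTop y M) ≃ₗ[R] (N →ₗ[R] QuotSMulTop (x * y) M)) := by
  have hle : y • (⊤ : Submodule R M) ≤
      ((x * y) • (⊤ : Submodule R M)).comap (LinearMap.lsmul R M x) := by
    rintro _ ⟨m, -, rfl⟩
    exact ⟨m, trivial, mul_smul x y m⟩
  let φ : QuotSMulTop y M →ₗ[R] QuotSMulTop (x * y) M := Submodule.mapQ _ _ _ hle
  have hφ (m : M) : φ (Submodule.Quotient.mk m) = Submodule.Quotient.mk (x • m) := rfl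
  have hinj : Function.Injective φ := by
    rw [injective_iff_map_eq_zero]
    intro q hq
    obtain ⟨m, rfl⟩ := Submodule.Quotient.mk_surjective _ q
    rw [hφ, Submodule.Quotient.mk_eq_zero] at hq
    obtain ⟨t, -, ht⟩ := hq
    rw [Submodule.Quotient.mk_eq_zero]
    refine ⟨t, trivial, hx ?_⟩
    simpa [mul_smul] using ht
  have hrange (q : QuotSMulTop (x * y) M) (hq : y • q = 0) : q ∈ LinearMap.range φ := by
    obtain ⟨m, rfl⟩ := Submodule.Quotient.mk_surjective _ q
    rw [← Submodule.Quotient.mk_smul, Submodule.Quotient.mk_eq_zero] at hq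
    obtain ⟨t, -, ht⟩ := hq
    refine ⟨Submodule.Quotient.mk t, (hφ t).trans (congrArg _ (hy ?_))⟩
    simpa [mul_comm x y, mul_smul] using ht
  refine ⟨LinearEquiv.ofBijective (φ.compRight R) ⟨fun f g h => ?_, fun f => ?_⟩⟩
  · ext n
    exact hinj (LinearMap.congr_fun h n)
  · refine ⟨(LinearEquiv.ofInjective φ hinj).symm.toLinearMap ∘ₗ f.codRestrict _ fun n => ?_, ?_⟩
    · refine hrange _ ?_
      rw [← map_smul, mem_annihilator.mp hyN, map_zero]
    · ext n
      exact congrArg Subtype.val ((LinearEquiv.ofInjective φ hinj).apply_symm_apply _)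

/-- For `x` and `y` regular on `M` and killing `N`, `Hom(N, M/xM) ≃ Hom(N, M/yM)`. -/
theorem nonempty_linearMap_quotSMulTop_equiv {M : Type u} [AddCommGroup M] [Module R M] {x y : R}
    (hx : IsSMulRegular M x) (hy : IsSMulRegular M y)
    (hxN : x ∈ annihilator R N) (hyN : y ∈ annihilator R N) :
    Nonempty ((N →ₗ[R] QuotSMulTop x M) ≃ₗ[R] (N →ₗ[R] QuotSMulTop y M)) := by
  obtain ⟨e⟩ := nonempty_linearMap_quotSMulTop_mul_equiv (N := N) hx hy hyN
  obtain ⟨e'⟩ := nonempty_linearMap_quotSMulTop_mul_equiv (N := N) hy hx hxN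
  rw [mul_comm] at e'
  exact ⟨e' ≪≫ₗ e.symm⟩

/-- A common regular element in the annihilator of `N`. -/
theorem exists_mem_annihilator_isSMulRegular [IsNoetherianRing R] [Module.Finite R N]
    {M M' : Type u} [AddCommGroup M] [Module R M] [Module.Finite R M]
    [AddCommGroup M'] [Module R M'] [Module.Finite R M']
    (h : Subsingleton (N →ₗ[R] M)) (h' : Subsingleton (N →ₗ[R] M')) :
    ∃ c ∈ annihilator R N, IsSMulRegular M c ∧ IsSMulRegular M' c := by
  have : Subsingleton (N →ₗ[R] M × M') :=
    (LinearMap.prodEquiv R (M := N) (M₂ := M) (M₃ := M')).symm.toEquiv.subsingleton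
  obtain ⟨c, hc, hreg⟩ := IsSMulRegular.subsingleton_linearMap_iff.mp this
  refine ⟨c, hc, fun a b hab => ?_, fun a b hab => ?_⟩
  · exact congrArg Prod.fst (@hreg (a, 0) (b, 0) (Prod.ext hab rfl))
  · exact congrArg Prod.snd (@hreg (0, a) (0, b) (Prod.ext rfl hab))

variable [IsLocalRing R] [IsNoetherianRing R]

/-- Moving the head of a weakly regular sequence in a local ring to its end. -/
theorem isWeaklyRegular_cons_iff_last {M : Type u} [AddCommGroup M] [Module R M]
    [Module.Finite R M] {x : R} {xs : List R} (hm : ∀ r ∈ x :: xs, r ∈ maximalIdeal R) :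
    IsWeaklyRegular M (x :: xs) ↔ IsWeaklyRegular M xs ∧
      IsSMulRegular (M ⧸ (Ideal.ofList xs • ⊤ : Submodule R M)) x := by
  have hp : (x :: xs).Perm (xs ++ [x]) := (List.perm_append_singleton x xs).symm
  rw [← isWeaklyRegular_singleton_iff, ← isWeaklyRegular_append_iff]
  exact ⟨fun h => IsLocalRing.isWeaklyRegular_of_perm_of_subset_maximalIdeal h hp hm,
    fun h => IsLocalRing.isWeaklyRegular_of_perm_of_subset_maximalIdeal h hp.symm
      fun r hr => hm r (hp.mem_iff.mpr hr)⟩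

/-- If two sequences of the same length are weakly regular on `M` and kill `N`, then `Hom(N, -)`
takes isomorphic values at the corresponding quotients of `M`. -/
theorem nonempty_linearMap_quotient_ofList_equiv [Module.Finite R N]
    (hN : annihilator R N ≤ maximalIdeal R) (xs : List R) :
    ∀ (ys : List R) (M : Type u) [AddCommGroup M] [Module R M] [Module.Finite R M],
      xs.length = ys.length → (∀ r ∈ xs, r ∈ annihilator R N) → (∀ r ∈ ys, r ∈ annihilator R N) →
      IsWeaklyRegular M xs → IsWeaklyRegular M ys →
      Nonempty ((N →ₗ[R] M ⧸ (Ideal.ofList xs • ⊤ : Submodule R M)) ≃ₗ[R]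
        (N →ₗ[R] M ⧸ (Ideal.ofList ys • ⊤ : Submodule R M))) := by
  induction xs with
  | nil =>
    rintro (_ | ⟨y, ys⟩) M _ _ _ hlen - - - -
    · exact ⟨LinearEquiv.refl R _⟩
    · simp at hlen
  | cons x xs ih =>
    rintro (_ | ⟨y, ys⟩) M _ _ _ hlen hx hy hxM hyM
    · simp at hlen
    obtain ⟨hxs, hxr⟩ := (isWeaklyRegular_cons_iff_last fun r hr => hN (hx r hr)).mp hxM
    obtain ⟨hys, hyr⟩ := (isWeaklyRegular_cons_iff_last fun r hr => hN (hy r hr)).mp hyM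
    rw [List.forall_mem_cons] at hx hy
    obtain ⟨c, hc, hcx, hcy⟩ := exists_mem_annihilator_isSMulRegular (N := N)
      (IsSMulRegular.linearMap_subsingleton_of_mem_annihilator hxr hx.1)
      (IsSMulRegular.linearMap_subsingleton_of_mem_annihilator hyr hy.1)
    have key (z : R) (zs : List R) (hz : z ∈ annihilator R N) (hzs : ∀ r ∈ zs, r ∈ annihilator R N)
        (hzM : IsWeaklyRegular M zs)
        (hzr : IsSMulRegular (M ⧸ (Ideal.ofList zs • ⊤ : Submodule R M)) z)
        (hcr : IsSMulRegular (M ⧸ (Ideal.ofList zs • ⊤ : Submodule R M)) c) :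
        IsWeaklyRegular (QuotSMulTop c M) zs ∧
        Nonempty ((N →ₗ[R] M ⧸ (Ideal.ofList (z :: zs) • ⊤ : Submodule R M)) ≃ₗ[R]
          (N →ₗ[R] QuotSMulTop c M ⧸
            (Ideal.ofList zs • ⊤ : Submodule R (QuotSMulTop c M)))) := by
      constructor
      · refine ((isWeaklyRegular_cons_iff M c zs).mp
          ((isWeaklyRegular_cons_iff_last ?_).mpr ⟨hzM, hcr⟩)).2
        exact List.forall_mem_cons.mpr ⟨hN hc, fun r hr => hN (hzs r hr)⟩
      · obtain ⟨e⟩ := nonempty_linearMap_quotSMulTop_equiv (N := N) hzr hcr hz hc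
        exact ⟨(Submodule.quotOfListConsSMulTopEquivQuotSMulTopOuter M z zs).congrRight ≪≫ₗ e ≪≫ₗ
          ((Submodule.quotOfListConsSMulTopEquivQuotSMulTopOuter M c zs).symm ≪≫ₗ
            Submodule.quotOfListConsSMulTopEquivQuotSMulTopInner M c zs).congrRight⟩
    obtain ⟨hx', ⟨ex⟩⟩ := key x xs hx.1 hx.2 hxs hxr hcx
    obtain ⟨hy', ⟨ey⟩⟩ := key y ys hy.1 hy.2 hys hyr hcy
    obtain ⟨e⟩ := ih ys (QuotSMulTop c M) (by simpa using hlen) hx.2 hy.2 hx' hy'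
    exact ⟨ex ≪≫ₗ e ≪≫ₗ ey.symm⟩

/-- The head of a weakly regular sequence may be exchanged for any regular element. -/
theorem exists_isWeaklyRegular_cons (n : ℕ) :
    ∀ (x y : R) (ys : List R) (M : Type u) [AddCommGroup M] [Module R M] [Module.Finite R M],
      ys.length = n → x ∈ maximalIdeal R → (∀ r ∈ y :: ys, r ∈ maximalIdeal R) →
      IsSMulRegular M x → IsWeaklyRegular M (y :: ys) →
      ∃ zs : List R, zs.length = n ∧ (∀ r ∈ zs, r ∈ maximalIdeal R) ∧
        IsWeaklyRegular M (x :: zs) := by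
  induction n with
  | zero =>
    intro x y ys M _ _ _ _ _ _ hx _
    exact ⟨[], rfl, by simp, (isWeaklyRegular_singleton_iff M x).mpr hx⟩
  | succ n ih =>
    rintro x y (_ | ⟨y', ys⟩) M _ _ _ hlen hxm hym hx hy
    · simp at hlen
    simp only [List.forall_mem_cons] at hym
    obtain ⟨hym, hym', hysm⟩ := hym
    obtain ⟨hyr, hys⟩ := (isWeaklyRegular_cons_iff M _ _).mp hy
    have hann : annihilator R (ResidueField R) = maximalIdeal R := Ideal.annihilator_quotient
    have hsy : Subsingleton (ResidueField R →ₗ[R] QuotSMulTop y M) :=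
      IsSMulRegular.linearMap_subsingleton_of_mem_annihilator
        ((isWeaklyRegular_cons_iff _ _ _).mp hys).1 (hann ▸ hym')
    obtain ⟨e⟩ := nonempty_linearMap_quotSMulTop_equiv (N := ResidueField R) hx hyr
      (hann ▸ hxm) (hann ▸ hym)
    obtain ⟨c, hc, hcx, hcy⟩ := exists_mem_annihilator_isSMulRegular
      e.toEquiv.subsingleton hsy
    rw [hann] at hc
    have swap {a b : R} {l : List R} (ha : a ∈ maximalIdeal R) (hb : b ∈ maximalIdeal R)
        (hl : ∀ r ∈ l, r ∈ maximalIdeal R) (h : IsWeaklyRegular M (a :: b :: l)) :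
        IsWeaklyRegular M (b :: a :: l) :=
      IsLocalRing.isWeaklyRegular_of_perm_of_subset_maximalIdeal h (List.Perm.swap b a l)
        (List.forall_mem_cons.mpr ⟨ha, List.forall_mem_cons.mpr ⟨hb, hl⟩⟩)
    obtain ⟨zs, hzl, hzm, hz⟩ := ih c y' ys (QuotSMulTop y M) (by simpa using hlen) hc
      (List.forall_mem_cons.mpr ⟨hym', hysm⟩) hcy hys
    have h1 := (isWeaklyRegular_cons_iff M _ _).mp (swap hym hc hzm (hz.cons hyr))
    have h2 := (isWeaklyRegular_cons_iff M _ _).mp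
      (swap hxm hc (l := []) (by simp)
        (IsWeaklyRegular.cons hx ((isWeaklyRegular_singleton_iff _ _).mpr hcx)))
    obtain ⟨ws, hwl, hwm, hw⟩ := ih x y zs (QuotSMulTop c M) hzl hxm
      (List.forall_mem_cons.mpr ⟨hym, hzm⟩) ((isWeaklyRegular_singleton_iff _ _).mp h2.2) h1.2
    exact ⟨c :: ws, by simp [hwl], List.forall_mem_cons.mpr ⟨hc, hwm⟩,
      swap hc hxm hwm (hw.cons h1.1)⟩

end Exchange

section SystemOfParameters

variable {R : Type u} [CommRing R] [IsLocalRing R] [IsNoetherianRing R]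

/-- If `x` in the maximal ideal is regular on `M`, every associated prime of `M` is strictly
contained in an associated prime of `M/xM`. -/
theorem exists_isAssociatedPrime_quotSMulTop {M : Type u} [AddCommGroup M] [Module R M]
    [Module.Finite R M] {x : R} (hxm : x ∈ maximalIdeal R) (hx : IsSMulRegular M x)
    {p : Ideal R} (hp : IsAssociatedPrime p M) :
    x ∉ p ∧ ∃ q : Ideal R, IsAssociatedPrime q (QuotSMulTop x M) ∧ p ≤ q ∧ x ∈ q := by
  obtain ⟨hprime, m, hm⟩ := isAssociatedPrime_iff.mp hp
  have hmem (r : R) : r ∈ p ↔ r • m = 0 := by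
    rw [hm, Submodule.mem_colon_singleton, Submodule.mem_bot]
  have hm0 : m ≠ 0 := fun h =>
    hprime.ne_top ((Ideal.eq_top_iff_one p).mpr ((hmem 1).mpr (by simp [h])))
  have hxp : x ∉ p := fun h => hm0 (hx (by simpa using (hmem x).mp h))
  refine ⟨hxp, ?_⟩
  let U : Submodule R M := Submodule.torsionBySet R M p
  have hU (u : M) : u ∈ U ↔ ∀ r ∈ p, r • u = 0 := by
    simp [U, Submodule.mem_torsionBySet_iff]
  obtain ⟨u, huU, hu⟩ : ∃ u ∈ U, u ∉ x • (⊤ : Submodule R M) := by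
    by_contra! hcon
    have hle : U ≤ Ideal.span {x} • U := by
      intro u hu
      obtain ⟨t, -, rfl⟩ := hcon u hu
      refine Submodule.smul_mem_smul (Ideal.mem_span_singleton_self x)
        ((hU t).mpr fun r hr => hx ?_)
      have := (hU _).mp hu r hr
      simpa [smul_comm x r] using this
    have hbot : U = ⊥ := Submodule.eq_bot_of_le_smul_of_le_jacobson_bot _ U
      (IsNoetherian.noetherian U) hle
      (by rw [Ideal.span_singleton_le_iff_mem, IsLocalRing.jacobson_eq_maximalIdeal _ bot_ne_top]
          exact hxm)
    exact hm0 ((Submodule.eq_bot_iff U).mp hbot m ((hU m).mpr fun r hr => (hmem r).mp hr))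
  obtain ⟨q, hq, hle⟩ := exists_le_isAssociatedPrime_of_isNoetherianRing R
    (Submodule.Quotient.mk u : QuotSMulTop x M)
    (by rwa [Ne, Submodule.Quotient.mk_eq_zero])
  refine ⟨q, hq, fun r hr => hle ?_, hle ?_⟩
  · rw [Submodule.mem_colon_singleton, Submodule.mem_bot, ← Submodule.Quotient.mk_smul,
      (hU u).mp huU r hr, Submodule.Quotient.mk_zero]
  · rw [Submodule.mem_colon_singleton, Submodule.mem_bot, ← Submodule.Quotient.mk_smul,
      Submodule.Quotient.mk_eq_zero]
    exact ⟨u, trivial, rfl⟩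

/-- The length of a weakly regular sequence on `M` is at most the dimension of `R/p` for every
associated prime `p` of `M`. -/
theorem length_le_ringKrullDim_quotient_of_isAssociatedPrime (ys : List R) :
    ∀ (M : Type u) [AddCommGroup M] [Module R M] [Module.Finite R M] (p : Ideal R),
      (∀ r ∈ ys, r ∈ maximalIdeal R) → IsWeaklyRegular M ys → IsAssociatedPrime p M →
      (ys.length : WithBot ℕ∞) ≤ ringKrullDim (R ⧸ p) := by
  induction ys with
  | nil =>
    intro M _ _ _ p _ _ hp
    have := hp.isPrime
    simpa using ringKrullDim_nonneg_of_nontrivial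
  | cons y ys ih =>
    intro M _ _ _ p hm hy hp
    rw [List.forall_mem_cons] at hm
    obtain ⟨hyr, hys⟩ := (isWeaklyRegular_cons_iff M _ _).mp hy
    obtain ⟨hyp, q, hq, hpq, hyq⟩ := exists_isAssociatedPrime_quotSMulTop hm.1 hyr hp
    have hprime := hp.isPrime
    have h1 := ih (QuotSMulTop y M) q hm.2 hys hq
    have h2 : ringKrullDim ((R ⧸ p) ⧸ Ideal.span {Ideal.Quotient.mk p y}) + 1 ≤
        ringKrullDim (R ⧸ p) := ringKrullDim_quotient_succ_le_of_nonZeroDivisor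
      (mem_nonZeroDivisors_of_ne_zero (by rwa [Ne, Ideal.Quotient.eq_zero_iff_mem]))
    have h3 : ringKrullDim (R ⧸ q) ≤
        ringKrullDim ((R ⧸ p) ⧸ Ideal.span {Ideal.Quotient.mk p y}) := by
      refine ringKrullDim_le_of_surjective (Ideal.Quotient.lift _ (Ideal.Quotient.factor hpq) ?_)
        (Ideal.Quotient.lift_surjective_of_surjective _ _ (Ideal.Quotient.factor_surjective hpq))
      refine fun a ha => (Ideal.span_singleton_le_iff_mem (I := RingHom.ker _)).mpr ?_ ha
      exact Ideal.Quotient.eq_zero_iff_mem.mpr hyq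
    calc ((y :: ys).length : WithBot ℕ∞) = ys.length + 1 := by simp
      _ ≤ ringKrullDim ((R ⧸ p) ⧸ Ideal.span {Ideal.Quotient.mk p y}) + 1 := by
        gcongr; exact h1.trans h3
      _ ≤ _ := h2

/-- If the only prime containing `p` and `xs` is the maximal ideal, then `dim R/p` is at most the
length of `xs`. -/
theorem ringKrullDim_quotient_le_length {p : Ideal R} (hp : p.IsPrime) {xs : List R}
    (hm : ∀ r ∈ xs, r ∈ maximalIdeal R)
    (h : ∀ q : Ideal R, q.IsPrime → p ≤ q → (∀ r ∈ xs, r ∈ q) → q = maximalIdeal R) :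
    ringKrullDim (R ⧸ p) ≤ xs.length := by
  classical
  have hloc : IsLocalRing (R ⧸ p) := .of_surjective' _ Ideal.Quotient.mk_surjective
  let S : Finset (R ⧸ p) := (xs.map (Ideal.Quotient.mk p)).toFinset
  have hS : (S : Set (R ⧸ p)) ⊆ maximalIdeal (R ⧸ p) := by
    intro s hs
    obtain ⟨r, hr, rfl⟩ := by simpa [S] using hs
    have := IsLocalHom.of_surjective (Ideal.Quotient.mk p) Ideal.Quotient.mk_surjective
    exact fun hu => hm r hr (isUnit_of_map_unit (Ideal.Quotient.mk p) r hu)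
  have h1 := ringKrullDim_le_ringKrullDim_quotient_add_card S
    (by rwa [IsLocalRing.ringJacobson_eq_maximalIdeal])
  have h2 : ringKrullDim ((R ⧸ p) ⧸ Ideal.span (S : Set (R ⧸ p))) ≤ 0 := by
    have : Ring.KrullDimLE 0 ((R ⧸ p) ⧸ Ideal.span (S : Set (R ⧸ p))) := by
      rw [Ideal.krullDimLE_zero_quotient_iff_forall_minimalPrimes_isMaximal]
      intro J hJ
      have hJp := hJ.1.1
      have hJm : J.comap (Ideal.Quotient.mk p) = maximalIdeal R := by
        refine h _ inferInstance ?_ fun r hr => hJ.1.2 (Ideal.subset_span ?_)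
        · exact (Ideal.mk_ker (I := p)).symm.le.trans (Ideal.comap_mono bot_le)
        · simpa [S] using ⟨r, hr, rfl⟩
      have hJe : maximalIdeal (R ⧸ p) = J := by
        refine le_antisymm (fun s hs => ?_) (le_maximalIdeal hJp.ne_top)
        obtain ⟨r, rfl⟩ := Ideal.Quotient.mk_surjective s
        rw [← Ideal.mem_comap, hJm]
        exact fun hu => hs (hu.map _)
      exact hJe ▸ maximalIdeal.isMaximal _
    exact (Ring.krullDimLE_iff.mp this)
  calc _ ≤ _ := h1
    _ ≤ 0 + (xs.length : WithBot ℕ∞) := by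
      gcongr
      simpa [S] using (List.toFinset_card_le (xs.map (Ideal.Quotient.mk p)))
    _ = _ := zero_add _

/-- On a finite module with a regular sequence of length `n`, any sequence of length `n` which
cuts the support down to the closed point is weakly regular. -/
theorem isWeaklyRegular_of_forall_isPrime_eq_maximalIdeal (xs : List R) :
    ∀ (ys : List R) (M : Type u) [AddCommGroup M] [Module R M] [Module.Finite R M],
      ys.length = xs.length → (∀ r ∈ ys, r ∈ maximalIdeal R) → (∀ r ∈ xs, r ∈ maximalIdeal R) →
      (∀ q : Ideal R, q.IsPrime → annihilator R M ≤ q → (∀ r ∈ xs, r ∈ q) → q = maximalIdeal R) →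
      IsWeaklyRegular M ys → IsWeaklyRegular M xs := by
  induction xs with
  | nil => intros; exact IsWeaklyRegular.nil R _
  | cons x xs ih =>
    rintro (_ | ⟨y, ys⟩) M _ _ _ hlen hym hxm hq hy
    · simp at hlen
    have hxm' := List.forall_mem_cons.mp hxm
    have hx : IsSMulRegular M x := by
      rw [isSMulRegular_iff_right_eq_zero_of_smul]
      by_contra! ⟨m, hxm0, hm0⟩
      have hmem : x ∈ ⋃ p ∈ associatedPrimes R M, (p : Set R) := by
        rw [biUnion_associatedPrimes_eq_zero_divisors]
        exact ⟨m, hm0, hxm0⟩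
      obtain ⟨p, hp, hxp⟩ := Set.mem_iUnion₂.mp hmem
      have h1 := length_le_ringKrullDim_quotient_of_isAssociatedPrime (y :: ys) M p hym hy hp
      have h2 := ringKrullDim_quotient_le_length hp.isPrime hxm'.2 fun q hqp hpq hxq =>
        hq q hqp ((Submodule.annihilator_top.symm.le.trans hp.annihilator_le).trans hpq)
          (List.forall_mem_cons.mpr ⟨hpq hxp, hxq⟩)
      have h3 := h1.trans h2
      rw [hlen] at h3
      have h4 : (x :: xs).length ≤ xs.length := by exact_mod_cast h3
      simp at h4
    obtain ⟨zs, hzl, hzm, hz⟩ := exists_isWeaklyRegular_cons ys.length x y ys M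
      rfl hxm'.1 hym hx hy
    refine IsWeaklyRegular.cons hx (ih zs (QuotSMulTop x M) (by simpa [hzl] using hlen) hzm hxm'.2
      (fun q hqp hle hxq => hq q hqp (le_trans ?_ hle) (List.forall_mem_cons.mpr ⟨hle ?_, hxq⟩))
      ((isWeaklyRegular_cons_iff M _ _).mp hz).2)
    · exact LinearMap.annihilator_le_of_surjective _ (Submodule.mkQ_surjective _)
    · rw [mem_annihilator]
      intro m
      obtain ⟨m, rfl⟩ := Submodule.Quotient.mk_surjective _ m
      rw [← Submodule.Quotient.mk_smul, Submodule.Quotient.mk_eq_zero]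
      exact ⟨m, trivial, rfl⟩

end SystemOfParameters

/-- Evaluation at `1` identifies the endomorphisms of `R/I` with `R/I`. -/
theorem nonempty_linearMap_quotient_self_equiv {R : Type u} [CommRing R] (I : Ideal R) :
    Nonempty (((R ⧸ I) →ₗ[R] (R ⧸ I)) ≃ₗ[R] (R ⧸ I)) :=
  ⟨LinearMap.extendScalarsOfSurjectiveEquiv Ideal.Quotient.mk_surjective ≪≫ₗ
    (LinearMap.ringLmapEquivSelf (R ⧸ I) R (R ⧸ I))⟩

section CohenMacaulay

variable {R : Type u} [CommRing R] [IsLocalRing R] [IsNoetherianRing R]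

variable (R) in
theorem exists_ringKrullDim_eq_natCast : ∃ d : ℕ, ringKrullDim R = d := by
  have h := ringKrullDim_ne_top (R := R)
  rw [← IsLocalRing.maximalIdeal_height_eq_ringKrullDim] at h ⊢
  obtain ⟨d, hd⟩ := ENat.ne_top_iff_exists.mp fun ht => h (congrArg _ ht)
  exact ⟨d, congrArg _ hd.symm⟩

/-- A local ring is Cohen–Macaulay iff it has a regular sequence of length its dimension. -/
theorem isCohenMacaulayLocalRing_iff_exists_isWeaklyRegular :
    IsCohenMacaulayLocalRing R ↔ ∃ rs : List R, (∀ r ∈ rs, r ∈ maximalIdeal R) ∧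
      IsWeaklyRegular R rs ∧ ringKrullDim R = rs.length := by
  have hle (n : ℕ∞) (hn : n ∈ {n : ℕ∞ | ∃ (k : ℕ) (a : Fin k → R), (k : ℕ∞) = n ∧
      (∀ i, a i ∈ maximalIdeal R) ∧ IsRegular R (List.ofFn a)}) :
      (n : WithBot ℕ∞) ≤ ringKrullDim R := by
    obtain ⟨k, a, rfl, -, hreg⟩ := hn
    have hnt : Nontrivial (R ⧸ Ideal.ofList (List.ofFn a)) := by
      refine Ideal.Quotient.nontrivial_iff.mpr fun h => hreg.top_ne_smul ?_
      rw [h]; simp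
    rw [← ringKrullDim_add_length_eq_ringKrullDim_of_isRegular _ hreg]
    simpa using le_add_of_nonneg_left (a := ((k : ℕ∞) : WithBot ℕ∞))
      (ringKrullDim_nonneg_of_nontrivial (R := R ⧸ Ideal.ofList (List.ofFn a)))
  obtain ⟨d, hd⟩ := exists_ringKrullDim_eq_natCast R
  constructor
  · intro h
    rw [IsCohenMacaulayLocalRing, hd] at h
    have hdepth : ringDepth R = d := by exact_mod_cast h
    have hne : Nonempty {n : ℕ∞ | ∃ (k : ℕ) (a : Fin k → R), (k : ℕ∞) = n ∧
        (∀ i, a i ∈ maximalIdeal R) ∧ IsRegular R (List.ofFn a)} :=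
      ⟨0, 0, Fin.elim0, rfl, fun i => i.elim0, by simpa using IsRegular.nil R R⟩
    obtain ⟨k, a, hk, ha, hreg⟩ := ENat.sSup_mem_of_nonempty_of_lt_top
      (hdepth.trans_lt (ENat.natCast_lt_top d))
    refine ⟨List.ofFn a, by simpa [List.forall_mem_ofFn_iff] using ha, hreg.toIsWeaklyRegular, ?_⟩
    have hkd : k = d := by exact_mod_cast hk.trans hdepth
    rw [hd, List.length_ofFn, hkd]
  · rintro ⟨rs, hm, hreg, hdim⟩
    refine le_antisymm ?_ ?_
    · rw [hd]
      exact_mod_cast sSup_le fun n hn => by exact_mod_cast hd ▸ hle n hn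
    · rw [hdim]
      refine WithBot.coe_le_coe.mpr (le_sSup
        ⟨rs.length, rs.get, rfl, fun i => hm _ (rs.get_mem i), ?_⟩)
      rw [List.ofFn_get]
      exact .of_isWeaklyRegular_of_mem_maximalIdeal R hm hreg

/-- In a Cohen–Macaulay local ring, `Hom(R/a, R/b) ≃ R/a` for parameter ideals `b ≤ a`. -/
theorem IsCohenMacaulayLocalRing.nonempty_linearMap_quotient_equiv
    (h : IsCohenMacaulayLocalRing R) {a b : Ideal R} (ha : IsParameterIdeal R a)
    (hb : IsParameterIdeal R b) (hba : b ≤ a) :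
    Nonempty (((R ⧸ a) →ₗ[R] (R ⧸ b)) ≃ₗ[R] (R ⧸ a)) := by
  obtain ⟨rs, hm, hreg, hdim⟩ := isCohenMacaulayLocalRing_iff_exists_isWeaklyRegular.mp h
  have key (c : Ideal R) (hc : IsParameterIdeal R c) : ∃ xs : List R, xs.length = rs.length ∧
      Ideal.ofList xs = c ∧ IsWeaklyRegular R xs := by
    obtain ⟨d, x, hd, hx, rfl, hrad⟩ := hc
    have hlen : (List.ofFn x).length = rs.length := by
      rw [List.length_ofFn]; exact_mod_cast hd.symm.trans hdim
    have hspan : Ideal.ofList (List.ofFn x) = Ideal.span (Set.range x) := by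
      simp [Ideal.ofList, List.mem_ofFn, Set.range]
    refine ⟨List.ofFn x, hlen, hspan, isWeaklyRegular_of_forall_isPrime_eq_maximalIdeal _ rs R
      hlen.symm hm ?_ (fun q hq _ hxq => ?_) hreg⟩
    · simpa [List.forall_mem_ofFn_iff] using hx
    · refine le_antisymm (le_maximalIdeal hq.ne_top) ?_
      rw [← hrad, hq.radical_le_iff, ← hspan]
      exact Ideal.span_le.mpr hxq
  obtain ⟨xs, hxl, rfl, hxs⟩ := key a ha
  obtain ⟨ys, hyl, rfl, hys⟩ := key b hb
  have hann : annihilator R (R ⧸ Ideal.ofList xs) = Ideal.ofList xs := Ideal.annihilator_quotient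
  have hle : Ideal.ofList xs ≤ maximalIdeal R := by
    obtain ⟨d, x, -, hx, he, -⟩ := ha
    rw [he, Ideal.span_le]
    rintro _ ⟨i, rfl⟩
    exact hx i
  obtain ⟨e⟩ := nonempty_linearMap_quotient_ofList_equiv (N := R ⧸ Ideal.ofList xs)
    (hann.trans_le hle) ys xs R (hyl.trans hxl.symm)
    (fun r hr => hann.ge (hba (Ideal.subset_span hr)))
    (fun r hr => hann.ge (Ideal.subset_span hr)) hys hxs
  have hsmul (l : List R) : Ideal.ofList l = (Ideal.ofList l • ⊤ : Submodule R R) := by simp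
  obtain ⟨f⟩ := nonempty_linearMap_quotient_self_equiv (Ideal.ofList xs)
  exact ⟨(Submodule.quotEquivOfEq _ _ (hsmul ys)).congrRight ≪≫ₗ e ≪≫ₗ
    (Submodule.quotEquivOfEq _ _ (hsmul xs)).symm.congrRight ≪≫ₗ f⟩

end CohenMacaulay

section PrincipalColons

variable {R : Type u} [CommRing R] [IsLocalRing R] [IsNoetherianRing R]

variable (R) in
/-- For parameter ideals `b ≤ a`, the quotient `(b : a) / b` is cyclic. -/
def HasPrincipalParameterColons : Prop :=
  ∀ a b : Ideal R, IsParameterIdeal R a → IsParameterIdeal R b → b ≤ a →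
    ∃ z : R, (∀ t ∈ a, t * z ∈ b) ∧ ∀ w : R, (∀ t ∈ a, t * w ∈ b) → w ∈ b ⊔ Ideal.span {z}

omit [IsLocalRing R] [IsNoetherianRing R] in
theorem exists_forall_mem_sup_span_of_linearEquiv {a b : Ideal R}
    (e : ((R ⧸ a) →ₗ[R] (R ⧸ b)) ≃ₗ[R] (R ⧸ a)) :
    ∃ z : R, (∀ t ∈ a, t * z ∈ b) ∧ ∀ w : R, (∀ t ∈ a, t * w ∈ b) → w ∈ b ⊔ Ideal.span {z} := by
  obtain ⟨z, hz⟩ := Ideal.Quotient.mk_surjective (e.symm 1 (1 : R ⧸ a))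
  have hev (f : (R ⧸ a) →ₗ[R] (R ⧸ b)) (t : R) : f (Ideal.Quotient.mk a t) = t • f 1 := by
    rw [← map_smul]
    congr 1
    rw [Algebra.smul_def, mul_one]
    rfl
  refine ⟨z, fun t ht => ?_, fun w hw => ?_⟩
  · rw [← Ideal.Quotient.eq_zero_iff_mem, map_mul, hz, ← Ideal.Quotient.algebraMap_eq,
      ← Algebra.smul_def, ← hev, Ideal.Quotient.eq_zero_iff_mem.mpr ht, map_zero]
  · let f : (R ⧸ a) →ₗ[R] (R ⧸ b) := Submodule.liftQ a
      (LinearMap.toSpanSingleton R (R ⧸ b) (Ideal.Quotient.mk b w)) fun t ht => by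
        rw [LinearMap.mem_ker, LinearMap.toSpanSingleton_apply, Algebra.smul_def,
          Ideal.Quotient.algebraMap_eq, ← map_mul]
        exact Ideal.Quotient.eq_zero_iff_mem.mpr (hw t ht)
    have hf : f 1 = Ideal.Quotient.mk b w := one_smul R (Ideal.Quotient.mk b w)
    obtain ⟨r, hr⟩ := Ideal.Quotient.mk_surjective (e f)
    have hfr : f = r • e.symm 1 := by
      rw [← map_smul, ← e.symm_apply_apply f, ← hr, Algebra.smul_def, mul_one]
      rfl
    have hw' : Ideal.Quotient.mk b w = Ideal.Quotient.mk b (r * z) := by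
      rw [← hf, hfr, LinearMap.smul_apply, ← hz, map_mul, Algebra.smul_def,
        Ideal.Quotient.algebraMap_eq]
    rw [← sub_add_cancel w (r * z)]
    exact Submodule.add_mem_sup (Ideal.Quotient.eq.mp hw')
      (Ideal.mul_mem_left _ _ (Ideal.mem_span_singleton_self z))

omit [IsNoetherianRing R] in
theorem isLocalRing_quotient_span_singleton {x : R} (hx : x ∈ maximalIdeal R) :
    IsLocalRing (R ⧸ Ideal.span {x}) :=
  have : Nontrivial (R ⧸ Ideal.span {x}) := Ideal.Quotient.nontrivial_iff.mpr fun h =>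
    (maximalIdeal.isMaximal R).ne_top
      (top_le_iff.mp (h ▸ (Ideal.span_singleton_le_iff_mem _).mpr hx))
  .of_surjective' _ Ideal.Quotient.mk_surjective

omit [IsNoetherianRing R] in
theorem comap_mk_maximalIdeal {I : Ideal R} [IsLocalRing (R ⧸ I)] :
    (maximalIdeal (R ⧸ I)).comap (Ideal.Quotient.mk I) = maximalIdeal R := by
  have : IsLocalHom (Ideal.Quotient.mk I) := .of_surjective _ Ideal.Quotient.mk_surjective
  ext r
  simp [mem_maximalIdeal, mem_nonunits_iff]

omit [IsNoetherianRing R] in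
theorem IsParameterIdeal.comap_mk {x : R} [IsLocalRing (R ⧸ Ideal.span {x})]
    (hx : x ∈ maximalIdeal R) (hdim : ringKrullDim (R ⧸ Ideal.span {x}) + 1 = ringKrullDim R)
    {I : Ideal (R ⧸ Ideal.span {x})} (hI : IsParameterIdeal _ I) :
    IsParameterIdeal R (I.comap (Ideal.Quotient.mk (Ideal.span {x}))) := by
  obtain ⟨d, a, hd, ha, rfl, hrad⟩ := hI
  choose b hb using fun i => Ideal.Quotient.mk_surjective (a i)
  refine ⟨d + 1, Fin.cons x b, ?_, ?_, ?_, ?_⟩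
  · rw [← hdim, hd]
    push_cast
    rfl
  · refine Fin.cases (by simpa using hx) fun i => ?_
    rw [Fin.cons_succ, ← comap_mk_maximalIdeal (I := Ideal.span {x}), Ideal.mem_comap, hb]
    exact ha i
  · have hra : Set.range a = Ideal.Quotient.mk (Ideal.span {x}) '' Set.range b := by
      rw [← Set.range_comp]
      exact congrArg _ (funext fun i => (hb i).symm)
    rw [Fin.range_cons, Ideal.span_insert, hra, ← Ideal.map_span,
      Ideal.comap_map_of_surjective' _ Ideal.Quotient.mk_surjective, Ideal.mk_ker, sup_comm]
  · rw [← Ideal.comap_radical, hrad, comap_mk_maximalIdeal]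

omit [IsNoetherianRing R] in
theorem HasPrincipalParameterColons.quotient (h : HasPrincipalParameterColons R) {x : R}
    [IsLocalRing (R ⧸ Ideal.span {x})] (hx : x ∈ maximalIdeal R)
    (hdim : ringKrullDim (R ⧸ Ideal.span {x}) + 1 = ringKrullDim R) :
    HasPrincipalParameterColons (R ⧸ Ideal.span {x}) := by
  intro a b ha hb hba
  obtain ⟨z, hz, hw⟩ := h _ _ (ha.comap_mk hx hdim) (hb.comap_mk hx hdim) (Ideal.comap_mono hba)
  refine ⟨Ideal.Quotient.mk _ z, fun t ht => ?_, fun w hwt => ?_⟩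
  · obtain ⟨t, rfl⟩ := Ideal.Quotient.mk_surjective t
    simpa using hz t ht
  · obtain ⟨w, rfl⟩ := Ideal.Quotient.mk_surjective w
    have := Ideal.mem_map_of_mem (Ideal.Quotient.mk (Ideal.span {x}))
      (hw w fun t ht => by simpa using hwt _ ht)
    rwa [Ideal.map_sup, Ideal.map_comap_of_surjective _ Ideal.Quotient.mk_surjective,
      Ideal.map_span, Set.image_singleton] at this

theorem ringKrullDim_quotient_span_singleton_add_one {x : R} (hx : x ∈ maximalIdeal R)
    (hmin : ∀ p ∈ minimalPrimes R, x ∉ p) :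
    ringKrullDim (R ⧸ Ideal.span {x}) + 1 = ringKrullDim R := by
  have h : Ideal.span {x} = x • (⊤ : Ideal R) := by simp [← Submodule.ideal_span_singleton_smul]
  have hann : annihilator R R = ⊥ := annihilator_eq_bot.mpr inferInstance
  have := Module.supportDim_quotSMulTop_succ_eq_of_notMem_minimalPrimes_of_mem_maximalIdeal
    (M := R) (x := x) (by rw [hann]; exact hmin) hx
  rw [Module.supportDim_self_eq_ringKrullDim] at this
  rw [← this, ← Module.supportDim_quotient_eq_ringKrullDim,
    Module.supportDim_eq_of_equiv (Submodule.quotEquivOfEq _ _ h)]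

theorem exists_mem_maximalIdeal_forall_notMem_minimalPrimes (h : 0 < ringKrullDim R) :
    ∃ x ∈ maximalIdeal R, ∀ p ∈ minimalPrimes R, x ∉ p := by
  by_contra! hcon
  have hsub : (maximalIdeal R : Set R) ⊆ ⋃ p ∈ minimalPrimes R, (id p : Ideal R) := fun x hx => by
    obtain ⟨p, hp, hxp⟩ := hcon x hx
    exact Set.mem_biUnion hp hxp
  obtain ⟨p, hp, hle⟩ := (Ideal.subset_union_prime_finite
    (minimalPrimes.finite_of_isNoetherianRing R) (f := id) 0 0 fun p hp _ _ => hp.1.1).mp hsub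
  have hpm : maximalIdeal R = p := (maximalIdeal.isMaximal R).eq_of_le hp.1.1.ne_top hle
  have := hp.1.1
  rw [← IsLocalRing.maximalIdeal_height_eq_ringKrullDim, hpm,
    (Ideal.height_eq_zero_iff (I := p)).mpr hp] at h
  exact h.ne rfl

end PrincipalColons

section Converse

variable {R : Type u} [CommRing R] [IsLocalRing R] [IsNoetherianRing R]

omit [IsNoetherianRing R] in
theorem isParameterIdeal_bot (h : ringKrullDim R = 0) : IsParameterIdeal R ⊥ := by
  have : Ring.KrullDimLE 0 R := ringKrullDimZero_iff_ringKrullDim_eq_zero.mpr h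
  exact ⟨0, Fin.elim0, by simpa using h, fun i => i.elim0, by simp,
    Ring.KrullDimLE.nilradical_eq_maximalIdeal R⟩

theorem isParameterIdeal_span_singleton_pow (h : ringKrullDim R = 1) {x : R}
    (hx : x ∈ maximalIdeal R) (hmin : ∀ p ∈ minimalPrimes R, x ∉ p) {n : ℕ} (hn : 0 < n) :
    IsParameterIdeal R (Ideal.span {x ^ n}) := by
  have hxn : x ^ n ∈ maximalIdeal R := Ideal.pow_mem_of_mem _ hx n hn
  have hdim := ringKrullDim_quotient_span_singleton_add_one hxn
    fun p hp hxp => hmin p hp (hp.1.1.mem_of_pow_mem n hxp)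
  have := isLocalRing_quotient_span_singleton hxn
  obtain ⟨d, hd⟩ := exists_ringKrullDim_eq_natCast (R ⧸ Ideal.span {x ^ n})
  have hd0 : d = 0 := by
    rw [hd, h] at hdim
    have : d + 1 = 1 := by exact_mod_cast hdim
    omega
  have := (isParameterIdeal_bot (by simpa [hd0] using hd)).comap_mk hxn hdim
  rwa [← RingHom.ker_eq_comap_bot, Ideal.mk_ker] at this

/-- In dimension one, cyclicity of `(b : a) / b` for `a = (x ^ n)` and `b = (x ^ (2 * n))` forces
the parameter `x` to be regular. -/
theorem HasPrincipalParameterColons.isSMulRegular (h : HasPrincipalParameterColons R)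
    (hdim : ringKrullDim R = 1) {x : R} (hx : x ∈ maximalIdeal R)
    (hmin : ∀ p ∈ minimalPrimes R, x ∉ p) : IsSMulRegular R x := by
  obtain ⟨N, hN⟩ := Filter.eventually_atTop.mp
    (Module.End.eventually_disjoint_ker_pow_range_pow (LinearMap.mulLeft R x))
  set n := N + 1 with hn
  have hdisj (r : R) (h0 : x ^ n * (x ^ n * r) = 0) : x ^ n * r = 0 := by
    refine Submodule.disjoint_def.mp (hN n (by omega)) _ ?_ ⟨r, ?_⟩ <;>
    simp [LinearMap.pow_mulLeft, h0]
  have hxn : x ^ n ∈ maximalIdeal R := Ideal.pow_mem_of_mem _ hx n (by omega)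
  obtain ⟨z, hz, hw⟩ := h (Ideal.span {x ^ n}) (Ideal.span {x ^ (2 * n)})
    (isParameterIdeal_span_singleton_pow hdim hx hmin (by omega))
    (isParameterIdeal_span_singleton_pow hdim hx hmin (by omega))
    (Ideal.span_singleton_le_span_singleton.mpr (pow_dvd_pow x (by omega)))
  have hw' (w : R) (hwx : x ^ n * w ∈ Ideal.span {x ^ (2 * n)}) : ∃ s, w = s * z := by
    let C : Ideal R := (Ideal.span {x ^ (2 * n)}).colon {x ^ n}
    have hC (r : R) : r ∈ C ↔ x ^ n * r ∈ Ideal.span {x ^ (2 * n)} := by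
      rw [Submodule.mem_colon_singleton, smul_eq_mul, mul_comm r]
    have hxC : x ^ n ∈ C := by
      rw [hC, ← pow_add, two_mul]
      exact Ideal.mem_span_singleton_self _
    have hle : C ≤ Ideal.span {z} := by
      refine Submodule.le_of_le_smul_of_le_jacobson_bot (I := maximalIdeal R)
        (IsNoetherian.noetherian C) (maximalIdeal_le_jacobson _) fun r hr => ?_
      have hr' := hw r fun t ht => by
        obtain ⟨s, rfl⟩ := Ideal.mem_span_singleton'.mp ht
        rw [mul_assoc]
        exact Ideal.mul_mem_left _ _ ((hC r).mp hr)
      refine (sup_comm (Ideal.span {x ^ (2 * n)}) _).le.trans (sup_le_sup_left ?_ _) hr'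
      rw [Ideal.span_singleton_le_iff_mem, two_mul, pow_add]
      exact Submodule.smul_mem_smul hxn hxC
    obtain ⟨s, hs⟩ := Ideal.mem_span_singleton'.mp (hle ((hC w).mpr hwx))
    exact ⟨s, hs.symm⟩
  obtain ⟨t, ht⟩ := Ideal.mem_span_singleton'.mp (hz _ (Ideal.mem_span_singleton_self _))
  obtain ⟨r, hr⟩ := hw' (x ^ n) (by rw [← pow_add, two_mul]; exact Ideal.mem_span_singleton_self _)
  rw [two_mul, pow_add] at ht
  have hkey : x ^ n * (1 - r * t) = 0 := hdisj _ <| by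
    linear_combination x ^ n * hr - r * ht
  have hregn : ∀ w, x ^ n * w = 0 → w = 0 := by
    intro w hw0
    rcases IsLocalRing.isUnit_or_isUnit_of_add_one (add_sub_cancel (r * t) 1) with hu | hu
    · obtain ⟨s, hs⟩ := hw' w (by rw [hw0]; exact Ideal.zero_mem _)
      obtain ⟨v, hv⟩ := (isUnit_of_mul_isUnit_left hu).exists_right_inv
      have hwx : w = x ^ n * (v * s) := by
        linear_combination hs - s * z * hv - v * s * hr
      rw [hwx] at hw0 ⊢
      exact hdisj _ hw0
    · obtain ⟨⟨p, hp⟩⟩ := Ideal.nonempty_minimalPrimes (bot_ne_top (α := Ideal R))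
      exact absurd (hp.1.1.mem_of_pow_mem n
        ((hu.mul_left_eq_zero.mp hkey).symm ▸ p.zero_mem)) (hmin p hp)
  refine isSMulRegular_iff_right_eq_zero_of_smul.mpr fun w hw0 => hregn w ?_
  rw [smul_eq_mul] at hw0
  rw [hn, pow_succ, mul_assoc, hw0, mul_zero]

/-- If every `R/(x ^ (n + 1))` has a regular element in its maximal ideal, then so does `R`. -/
theorem exists_isSMulRegular_of_forall_quotient_pow {x : R} (hx : x ∈ maximalIdeal R)
    (h : ∀ n : ℕ, ∃ c ∈ maximalIdeal R, IsSMulRegular (R ⧸ Ideal.span {x ^ (n + 1)}) c) :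
    ∃ y ∈ maximalIdeal R, IsSMulRegular R y := by
  have hsoc (w : R) (hw : ∀ c ∈ maximalIdeal R, c * w = 0) : w = 0 := by
    rw [← Ideal.mem_bot, ← Ideal.iInf_pow_eq_bot_of_isLocalRing (maximalIdeal R)
      (maximalIdeal.isMaximal R).ne_top, Ideal.mem_iInf]
    intro n
    obtain ⟨c, hc, hreg⟩ := h n
    have hw0 : Ideal.Quotient.mk (Ideal.span {x ^ (n + 1)}) w = 0 := by
      refine hreg.right_eq_zero_of_smul ?_
      rw [Algebra.smul_def, Ideal.Quotient.algebraMap_eq, ← map_mul, hw c hc, map_zero]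
    refine Ideal.pow_le_pow_right n.le_succ (?_ : w ∈ maximalIdeal R ^ (n + 1))
    exact (Ideal.span_singleton_le_iff_mem _).mpr (Ideal.pow_mem_pow hx (n + 1))
      (Ideal.Quotient.eq_zero_iff_mem.mp hw0)
  have hsub : Subsingleton (ResidueField R →ₗ[R] R) := by
    refine subsingleton_of_forall_eq 0 fun f => LinearMap.ext fun k => hsoc _ fun c hc => ?_
    rw [← smul_eq_mul, ← map_smul, Algebra.smul_def, ResidueField.algebraMap_eq,
      (residue_eq_zero_iff c).mpr hc, zero_mul, map_zero]
  obtain ⟨y, hy, hreg⟩ := IsSMulRegular.subsingleton_linearMap_iff.mp hsub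
  have hann : annihilator R (ResidueField R) = maximalIdeal R := Ideal.annihilator_quotient
  exact ⟨y, hann ▸ hy, hreg⟩

omit [IsNoetherianRing R] in
theorem exists_isWeaklyRegular_of_quotient {y : R} [IsLocalRing (R ⧸ Ideal.span {y})]
    (hreg : IsSMulRegular R y) {rs : List (R ⧸ Ideal.span {y})}
    (hm : ∀ r ∈ rs, r ∈ maximalIdeal (R ⧸ Ideal.span {y}))
    (hrs : IsWeaklyRegular (R ⧸ Ideal.span {y}) rs) :
    ∃ ss : List R, (∀ s ∈ ss, s ∈ maximalIdeal R) ∧ IsWeaklyRegular R (y :: ss) ∧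
      ss.length = rs.length := by
  obtain ⟨ss, rfl⟩ := List.map_surjective_iff.mpr Ideal.Quotient.mk_surjective rs
  have h : Ideal.span {y} = y • (⊤ : Ideal R) := by simp [← Submodule.ideal_span_singleton_smul]
  refine ⟨ss, fun s hs => ?_, .cons hreg ?_, by simp⟩
  · rw [← comap_mk_maximalIdeal (I := Ideal.span {y})]
    exact hm _ (List.mem_map_of_mem hs)
  · exact ((Submodule.quotEquivOfEq _ _ h).isWeaklyRegular_congr ss).mp
      ((isWeaklyRegular_map_algebraMap_iff (R ⧸ Ideal.span {y}) _ ss).mp hrs)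

end Converse

theorem HasPrincipalParameterColons.exists_isWeaklyRegular (d : ℕ) :
    ∀ (R : Type u) [CommRing R] [IsLocalRing R] [IsNoetherianRing R],
      HasPrincipalParameterColons R → ringKrullDim R = d →
      ∃ rs : List R, (∀ r ∈ rs, r ∈ maximalIdeal R) ∧ IsWeaklyRegular R rs ∧ rs.length = d := by
  induction d with
  | zero => exact fun R _ _ _ _ _ => ⟨[], by simp, .nil R R, rfl⟩
  | succ d ih =>
    intro R _ _ _ h hd
    have key {y : R} (hy : y ∈ maximalIdeal R)
        (hdim : ringKrullDim (R ⧸ Ideal.span {y}) + 1 = ringKrullDim R) :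
        ∃ _ : IsLocalRing (R ⧸ Ideal.span {y}), ∃ rs : List (R ⧸ Ideal.span {y}),
          (∀ r ∈ rs, r ∈ maximalIdeal (R ⧸ Ideal.span {y})) ∧
          IsWeaklyRegular (R ⧸ Ideal.span {y}) rs ∧ rs.length = d := by
      have hloc := isLocalRing_quotient_span_singleton hy
      refine ⟨hloc, ih _ (h.quotient hy hdim) ?_⟩
      obtain ⟨e, he⟩ := exists_ringKrullDim_eq_natCast (R ⧸ Ideal.span {y})
      rw [he, hd] at hdim
      have : e + 1 = d + 1 := by exact_mod_cast hdim
      rw [he, Nat.succ_injective this]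
    have hpos : 0 < ringKrullDim R := by
      rw [hd]
      exact_mod_cast d.succ_pos
    obtain ⟨x, hx, hmin⟩ := exists_mem_maximalIdeal_forall_notMem_minimalPrimes hpos
    obtain ⟨y, hy, hreg⟩ : ∃ y ∈ maximalIdeal R, IsSMulRegular R y := by
      cases d with
      | zero => exact ⟨x, hx, h.isSMulRegular (by simpa using hd) hx hmin⟩
      | succ d =>
        refine exists_isSMulRegular_of_forall_quotient_pow hx fun n => ?_
        have hxn : x ^ (n + 1) ∈ maximalIdeal R := Ideal.pow_mem_of_mem _ hx _ n.succ_pos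
        obtain ⟨_, rs, hm, hrs, hlen⟩ := key hxn (ringKrullDim_quotient_span_singleton_add_one hxn
          fun p hp hxp => hmin p hp (hp.1.1.mem_of_pow_mem _ hxp))
        obtain ⟨c, rs, rfl⟩ := List.exists_cons_of_length_eq_add_one hlen
        obtain ⟨c, rfl⟩ := Ideal.Quotient.mk_surjective c
        refine ⟨c, ?_, ?_⟩
        · rw [← comap_mk_maximalIdeal (I := Ideal.span {x ^ (n + 1)})]
          exact hm _ List.mem_cons_self
        · have hc := ((isWeaklyRegular_cons_iff _ _ _).mp hrs).1
          exact fun a b hab => hc (by simpa [Algebra.smul_def] using hab)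
    obtain ⟨_, rs, hm, hrs, hlen⟩ := key hy
      (ringKrullDim_quotient_span_singleton_succ_eq_ringKrullDim hreg hy)
    obtain ⟨ss, hss, hregs, hsl⟩ := exists_isWeaklyRegular_of_quotient hreg hm hrs
    exact ⟨y :: ss, List.forall_mem_cons.mpr ⟨hy, hss⟩, hregs, by simp [hsl, hlen]⟩

theorem isCohenMacaulay_iff_hom_quotient_iso (R : Type*) [CommRing R] [IsNoetherianRing R] [IsLocalRing R] :
    IsCohenMacaulayLocalRing R ↔
      ∀ a b : Ideal R, IsParameterIdeal R a → IsParameterIdeal R b → b ≤ a →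
        Nonempty (((R ⧸ a) →ₗ[R] (R ⧸ b)) ≃ₗ[R] (R ⧸ a)) := by
  refine ⟨fun h a b ha hb hba => h.nonempty_linearMap_quotient_equiv ha hb hba, fun h => ?_⟩
  obtain ⟨d, hd⟩ := exists_ringKrullDim_eq_natCast R
  obtain ⟨rs, hm, hrs, hlen⟩ := HasPrincipalParameterColons.exists_isWeaklyRegular d R
    (fun a b ha hb hba => exists_forall_mem_sup_span_of_linearEquiv (h a b ha hb hba).some) hd
  exact isCohenMacaulayLocalRing_iff_exists_isWeaklyRegular.mpr ⟨rs, hm, hrs, by rw [hd, hlen]⟩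
end

section
/- Let (R, m) be a commutative Noetherian local ring. Then R is Cohen-Macaulay if and only if for any parameter ideals a and b of R with b ⊆ a, the R-module Hom_R(R/a, R/b) is cyclic. -/
open IsLocalRing

open RingTheory.Sequence Pointwise

section Modules

variable {R : Type*} [CommRing R]

theorem Ideal.exists_mem_forall_notMem_of_finite {J : Ideal R} {s : Set (Ideal R)}
    (hs : s.Finite) (hprime : ∀ p ∈ s, p.IsPrime) (hJ : ∀ p ∈ s, ¬ J ≤ p) :
    ∃ z ∈ J, ∀ p ∈ s, z ∉ p := by
  by_contra! h
  obtain ⟨p, hp, hle⟩ := (Ideal.subset_union_prime_finite (I := J) hs (f := id) 0 0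
    fun p hp _ _ ↦ hprime p hp).1 fun z hz ↦ by
      obtain ⟨p, hp, hzp⟩ := h z hz
      exact Set.mem_biUnion hp hzp
  exact hJ p hp hle

variable {M : Type*} [AddCommGroup M] [Module R M]

theorem isSMulRegular_of_forall_notMem_associatedPrimes [IsNoetherianRing R] {z : R}
    (h : ∀ p ∈ associatedPrimes R M, z ∉ p) : IsSMulRegular M z := by
  by_contra hz
  have : z ∈ ⋃ p ∈ associatedPrimes R M, (p : Set R) := by
    rw [biUnion_associatedPrimes_eq_compl_regular]
    exact hz
  simp only [Set.mem_iUnion] at this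
  obtain ⟨p, hp, hzp⟩ := this
  exact h p hp hzp

theorem IsSMulRegular.notMem_of_mem_associatedPrimes [IsNoetherianRing R] {x : R}
    (h : IsSMulRegular M x) {p : Ideal R} (hp : p ∈ associatedPrimes R M) : x ∉ p := by
  intro hx
  have : x ∈ ⋃ p ∈ associatedPrimes R M, (p : Set R) := Set.mem_biUnion hp hx
  rw [biUnion_associatedPrimes_eq_compl_regular] at this
  exact this h

theorem isWeaklyRegular_cons_iff_of_mem_maximalIdeal [IsLocalRing R] [IsNoetherian R M]
    {x : R} {xs : List R} (hx : x ∈ maximalIdeal R) (hxs : ∀ r ∈ xs, r ∈ maximalIdeal R) :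
    IsWeaklyRegular M (x :: xs) ↔ IsWeaklyRegular M xs ∧
      IsSMulRegular (M ⧸ (Ideal.ofList xs • ⊤ : Submodule R M)) x := by
  rw [← isWeaklyRegular_singleton_iff, ← isWeaklyRegular_append_iff]
  have hp : (x :: xs).Perm (xs ++ [x]) := (List.perm_append_singleton x xs).symm
  have hm : ∀ r ∈ x :: xs, r ∈ maximalIdeal R := by simpa using ⟨hx, hxs⟩
  exact ⟨fun h ↦ IsLocalRing.isWeaklyRegular_of_perm_of_subset_maximalIdeal h hp hm,
    fun h ↦ IsLocalRing.isWeaklyRegular_of_perm_of_subset_maximalIdeal h hp.symm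
      fun r hr ↦ hm r (hp.mem_iff.2 hr)⟩

/-- The pairs `(m, m')` with `z m = x m'`. -/
def pullbackSMul (M : Type*) [AddCommGroup M] [Module R M] (x z : R) : Submodule R (M × M) :=
  LinearMap.ker ((LinearMap.lsmul R M z).comp (LinearMap.fst R M M) -
    (LinearMap.lsmul R M x).comp (LinearMap.snd R M M))

theorem mem_pullbackSMul {x z : R} {p : M × M} :
    p ∈ pullbackSMul M x z ↔ z • p.1 = x • p.2 := by
  simp [pullbackSMul, sub_eq_zero]

/-- The map sending a pair `(m, m')` with `z m = x m'` to the class of `m` modulo `x M`. -/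
def pullbackSMulFst (M : Type*) [AddCommGroup M] [Module R M] (x z : R) :
    pullbackSMul M x z →ₗ[R] Submodule.torsionBy R (QuotSMulTop x M) z :=
  LinearMap.codRestrict _
    (((x • (⊤ : Submodule R M)).mkQ.comp (LinearMap.fst R M M)).comp (pullbackSMul M x z).subtype)
    fun p ↦ by
      rw [Submodule.mem_torsionBy_iff]
      change Submodule.Quotient.mk (z • p.1.1) = 0
      rw [mem_pullbackSMul.1 p.2, Submodule.Quotient.mk_eq_zero]
      exact Submodule.smul_mem_pointwise_smul _ _ _ trivial

/-- The map sending a pair `(m, m')` with `z m = x m'` to the class of `m'` modulo `z M`. -/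
def pullbackSMulSnd (M : Type*) [AddCommGroup M] [Module R M] (x z : R) :
    pullbackSMul M x z →ₗ[R] Submodule.torsionBy R (QuotSMulTop z M) x :=
  LinearMap.codRestrict _
    (((z • (⊤ : Submodule R M)).mkQ.comp (LinearMap.snd R M M)).comp (pullbackSMul M x z).subtype)
    fun p ↦ by
      rw [Submodule.mem_torsionBy_iff]
      change Submodule.Quotient.mk (x • p.1.2) = 0
      rw [← mem_pullbackSMul.1 p.2, Submodule.Quotient.mk_eq_zero]
      exact Submodule.smul_mem_pointwise_smul _ _ _ trivial

theorem pullbackSMulFst_surjective (x z : R) :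
    Function.Surjective (pullbackSMulFst M x z) := by
  rintro ⟨q, hq⟩
  obtain ⟨m, rfl⟩ := Submodule.Quotient.mk_surjective _ q
  rw [Submodule.mem_torsionBy_iff, ← Submodule.Quotient.mk_smul, Submodule.Quotient.mk_eq_zero,
    Submodule.mem_smul_pointwise_iff_exists] at hq
  obtain ⟨m', -, hm'⟩ := hq
  exact ⟨⟨(m, m'), mem_pullbackSMul.2 hm'.symm⟩, rfl⟩

theorem pullbackSMulSnd_surjective (x z : R) :
    Function.Surjective (pullbackSMulSnd M x z) := by
  rintro ⟨q, hq⟩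
  obtain ⟨m, rfl⟩ := Submodule.Quotient.mk_surjective _ q
  rw [Submodule.mem_torsionBy_iff, ← Submodule.Quotient.mk_smul, Submodule.Quotient.mk_eq_zero,
    Submodule.mem_smul_pointwise_iff_exists] at hq
  obtain ⟨m', -, hm'⟩ := hq
  exact ⟨⟨(m', m), mem_pullbackSMul.2 hm'⟩, rfl⟩

theorem ker_pullbackSMulFst_eq_ker_pullbackSMulSnd {x z : R} (hx : IsSMulRegular M x)
    (hz : IsSMulRegular M z) :
    LinearMap.ker (pullbackSMulFst M x z) = LinearMap.ker (pullbackSMulSnd M x z) := by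
  ext ⟨⟨m, m'⟩, h⟩
  replace h : z • m = x • m' := mem_pullbackSMul.1 h
  rw [LinearMap.mem_ker, LinearMap.mem_ker, ← Subtype.coe_inj, ← Subtype.coe_inj]
  change Submodule.Quotient.mk m = 0 ↔ Submodule.Quotient.mk m' = 0
  rw [Submodule.Quotient.mk_eq_zero, Submodule.Quotient.mk_eq_zero,
    Submodule.mem_smul_pointwise_iff_exists, Submodule.mem_smul_pointwise_iff_exists]
  constructor
  · rintro ⟨n, -, rfl⟩
    exact ⟨n, trivial, hx (by simpa [smul_comm x z] using h)⟩
  · rintro ⟨n, -, rfl⟩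
    exact ⟨n, trivial, hz (by simpa [smul_comm x z] using h.symm)⟩

/-- If `x` and `z` are `M`-regular, then `0 :_{M/xM} z ≃ 0 :_{M/zM} x`. -/
noncomputable def torsionByQuotSMulTopEquiv {x z : R} (hx : IsSMulRegular M x)
    (hz : IsSMulRegular M z) :
    Submodule.torsionBy R (QuotSMulTop x M) z ≃ₗ[R] Submodule.torsionBy R (QuotSMulTop z M) x :=
  ((pullbackSMulFst M x z).quotKerEquivOfSurjective (pullbackSMulFst_surjective x z)).symm ≪≫ₗ
    Submodule.quotEquivOfEq _ _ (ker_pullbackSMulFst_eq_ker_pullbackSMulSnd hx hz) ≪≫ₗ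
    (pullbackSMulSnd M x z).quotKerEquivOfSurjective (pullbackSMulSnd_surjective x z)

/-- If `z` kills `N`, homomorphisms from `N` to `M` land in the `z`-torsion of `M`. -/
def homTorsionByEquiv {N : Type*} [AddCommGroup N] [Module R N] (M : Type*) [AddCommGroup M]
    [Module R M] {z : R} (hz : z ∈ Module.annihilator R N) :
    (N →ₗ[R] M) ≃ₗ[R] (N →ₗ[R] Submodule.torsionBy R M z) where
  toFun f := LinearMap.codRestrict _ f fun n ↦ by
    rw [Submodule.mem_torsionBy_iff, ← map_smul, Module.mem_annihilator.1 hz, map_zero]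
  map_add' _ _ := rfl
  map_smul' _ _ := rfl
  invFun g := (Submodule.torsionBy R M z).subtype.comp g
  left_inv _ := rfl
  right_inv _ := rfl

theorem nonempty_hom_quotSMulTop_equiv {N : Type*} [AddCommGroup N] [Module R N] {x z : R}
    (hx : IsSMulRegular M x) (hz : IsSMulRegular M z) (hxN : x ∈ Module.annihilator R N)
    (hzN : z ∈ Module.annihilator R N) :
    Nonempty ((N →ₗ[R] QuotSMulTop x M) ≃ₗ[R] (N →ₗ[R] QuotSMulTop z M)) :=
  ⟨homTorsionByEquiv _ hzN ≪≫ₗ (torsionByQuotSMulTopEquiv hx hz).congrRight ≪≫ₗ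
    (homTorsionByEquiv _ hxN).symm⟩

variable [IsLocalRing R]

theorem supportDim_nonneg_of_nontrivial (R M : Type*) [CommRing R] [AddCommGroup M] [Module R M]
    [Nontrivial M] : 0 ≤ Module.supportDim R M :=
  not_lt.1 fun h ↦
    Module.supportDim_ne_bot_of_nontrivial R M ((WithBot.lt_zero_iff_eq_bot _).1 h)

theorem supportDim_nonpos_iff_support_subset [Module.Finite R M] :
    Module.supportDim R M ≤ 0 ↔
      Module.support R M ⊆ PrimeSpectrum.zeroLocus (maximalIdeal R) := by
  constructor
  · intro h
    cases subsingleton_or_nontrivial M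
    · simp [Module.support_eq_empty]
    · exact (support_of_supportDim_eq_zero R M
        (le_antisymm h (supportDim_nonneg_of_nontrivial R M))).subset
  · intro h
    have : Subsingleton (Module.support R M) := by
      refine ⟨fun p q ↦ Subtype.ext (PrimeSpectrum.ext ?_)⟩
      have key (p : Module.support R M) : p.1.asIdeal = maximalIdeal R :=
        le_antisymm (le_maximalIdeal p.1.2.ne_top) (h p.2)
      rw [key p, key q]
    exact Order.krullDim_nonpos_of_subsingleton

theorem supportDim_nonpos_of_maximalIdeal_mem_minimalPrimes [Module.Finite R M]
    (h : maximalIdeal R ∈ (Module.annihilator R M).minimalPrimes) :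
    Module.supportDim R M ≤ 0 := by
  rw [supportDim_nonpos_iff_support_subset, Module.support_eq_zeroLocus]
  exact fun p hp ↦ h.2 ⟨p.2, hp⟩ (le_maximalIdeal p.2.ne_top)

theorem isSMulRegular_of_supportDim_quotSMulTop_nonpos [Module.Finite R M] {y z : R}
    (hz : IsSMulRegular M z) (hzm : z ∈ maximalIdeal R)
    (hy : Module.supportDim R (QuotSMulTop y M) ≤ 0) : IsSMulRegular M y := by
  rw [supportDim_nonpos_iff_support_subset, Module.support_quotSMulTop,
    Module.support_eq_zeroLocus] at hy
  have hzr : z ∈ (Module.annihilator R M ⊔ Ideal.span {y}).radical := by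
    rw [Ideal.radical_eq_sInf, Submodule.mem_sInf]
    rintro p ⟨hle, hp⟩
    have hyp : y ∈ p := hle (Ideal.mem_sup_right (Ideal.mem_span_singleton_self y))
    exact hy (a := ⟨p, hp⟩) ⟨le_sup_left.trans hle, by simpa using hyp⟩ hzm
  obtain ⟨k, hk⟩ := hzr
  obtain ⟨a, ha, c, hc, hac⟩ := Submodule.mem_sup.1 hk
  obtain ⟨r, rfl⟩ := Ideal.mem_span_singleton'.1 hc
  refine (isSMulRegular_iff_right_eq_zero_of_smul).2 fun w hw ↦ ?_
  refine (isSMulRegular_iff_right_eq_zero_of_smul).1 (hz.pow k) w ?_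
  rw [← hac, add_smul, mul_smul, hw, Module.mem_annihilator.1 ha]
  simp

variable [IsNoetherianRing R]

theorem nonempty_hom_quotient_ofList_equiv {N : Type*} [AddCommGroup N] [Module R N]
    {J : Ideal R} (hJ : J ≤ maximalIdeal R) (hJN : J ≤ Module.annihilator R N) (n : ℕ) :
    ∀ (M : Type*) [AddCommGroup M] [Module R M] [Module.Finite R M] (xs ys : List R),
      xs.length = n → ys.length = n → (∀ r ∈ xs, r ∈ J) → (∀ r ∈ ys, r ∈ J) →
      IsWeaklyRegular M xs → IsWeaklyRegular M ys →
      Nonempty ((N →ₗ[R] M ⧸ (Ideal.ofList xs • ⊤ : Submodule R M)) ≃ₗ[R]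
        (N →ₗ[R] M ⧸ (Ideal.ofList ys • ⊤ : Submodule R M))) := by
  induction n with
  | zero =>
    intro M _ _ _ xs ys hxl hyl _ _ _ _
    rw [List.length_eq_zero_iff] at hxl hyl
    subst hxl hyl
    exact ⟨.refl _ _⟩
  | succ n ih =>
    intro M _ _ _ xs ys hxl hyl hxJ hyJ hx hy
    obtain ⟨x, xs, rfl⟩ := List.exists_cons_of_length_eq_add_one hxl
    obtain ⟨y, ys, rfl⟩ := List.exists_cons_of_length_eq_add_one hyl
    simp only [List.mem_cons, forall_eq_or_imp, List.length_cons, Nat.add_right_cancel_iff] at *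
    have hxm r hr := hJ (hxJ.2 r hr)
    have hym r hr := hJ (hyJ.2 r hr)
    rw [isWeaklyRegular_cons_iff_of_mem_maximalIdeal (hJ hxJ.1) hxm] at hx
    rw [isWeaklyRegular_cons_iff_of_mem_maximalIdeal (hJ hyJ.1) hym] at hy
    obtain ⟨z, hzJ, hz⟩ := Ideal.exists_mem_forall_notMem_of_finite (J := J)
      ((associatedPrimes.finite R (M ⧸ (Ideal.ofList xs • ⊤ : Submodule R M))).union
        (associatedPrimes.finite R (M ⧸ (Ideal.ofList ys • ⊤ : Submodule R M))))
      (by rintro p (hp | hp) <;> exact hp.1)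
      (by
        rintro p (hp | hp) hle
        · exact hx.2.notMem_of_mem_associatedPrimes hp (hle hxJ.1)
        · exact hy.2.notMem_of_mem_associatedPrimes hp (hle hyJ.1))
    have hzx := isSMulRegular_of_forall_notMem_associatedPrimes fun p hp ↦ hz p (.inl hp)
    have hzy := isSMulRegular_of_forall_notMem_associatedPrimes fun p hp ↦ hz p (.inr hp)
    have hx' := (isWeaklyRegular_cons_iff _ _ _).1
      ((isWeaklyRegular_cons_iff_of_mem_maximalIdeal (hJ hzJ) hxm).2 ⟨hx.1, hzx⟩)
    have hy' := (isWeaklyRegular_cons_iff _ _ _).1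
      ((isWeaklyRegular_cons_iff_of_mem_maximalIdeal (hJ hzJ) hym).2 ⟨hy.1, hzy⟩)
    obtain ⟨e⟩ := ih (QuotSMulTop z M) xs ys hxl hyl hxJ.2 hyJ.2 hx'.2 hy'.2
    obtain ⟨ex⟩ := nonempty_hom_quotSMulTop_equiv hx.2 hzx (hJN hxJ.1) (hJN hzJ)
    obtain ⟨ey⟩ := nonempty_hom_quotSMulTop_equiv hzy hy.2 (hJN hzJ) (hJN hyJ.1)
    let i (r : R) (rs : List R) := Submodule.quotOfListConsSMulTopEquivQuotSMulTopInner M r rs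
    let o (r : R) (rs : List R) := Submodule.quotOfListConsSMulTopEquivQuotSMulTopOuter M r rs
    exact ⟨(o x xs).congrRight ≪≫ₗ ex ≪≫ₗ ((o z xs).symm ≪≫ₗ i z xs).congrRight ≪≫ₗ e ≪≫ₗ
      ((i z ys).symm ≪≫ₗ o z ys).congrRight ≪≫ₗ ey ≪≫ₗ (o y ys).symm.congrRight⟩

theorem supportDim_le_supportDim_quotient_ofList_add_length (ys : List R)
    (hys : ∀ r ∈ ys, r ∈ maximalIdeal R) :
    ∀ (M : Type*) [AddCommGroup M] [Module R M] [Module.Finite R M],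
      Module.supportDim R M ≤
        Module.supportDim R (M ⧸ (Ideal.ofList ys • ⊤ : Submodule R M)) + ys.length := by
  induction ys with
  | nil =>
    intro M _ _ _
    have : (Ideal.ofList ([] : List R) • ⊤ : Submodule R M) = ⊥ := by simp
    rw [Module.supportDim_eq_of_equiv (Submodule.quotEquivOfEqBot _ this)]
    simp
  | cons y ys ih =>
    intro M _ _ _
    simp only [List.mem_cons, forall_eq_or_imp] at hys
    rw [Module.supportDim_eq_of_equiv
      (Submodule.quotOfListConsSMulTopEquivQuotSMulTopInner M y ys)]
    refine (Module.supportDim_le_supportDim_quotSMulTop_succ hys.1).trans ?_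
    grw [ih hys.2 (QuotSMulTop y M)]
    rw [List.length_cons, add_assoc]
    push_cast
    rfl

theorem isWeaklyRegular_of_isWeaklyRegular_of_supportDim_nonpos (n : ℕ) :
    ∀ (M : Type*) [AddCommGroup M] [Module R M] [Module.Finite R M] [Nontrivial M]
      (xs ys : List R), xs.length = n → ys.length = n → (∀ r ∈ xs, r ∈ maximalIdeal R) →
      (∀ r ∈ ys, r ∈ maximalIdeal R) → IsWeaklyRegular M xs →
      Module.supportDim R (M ⧸ (Ideal.ofList ys • ⊤ : Submodule R M)) ≤ 0 →
      IsWeaklyRegular M ys := by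
  induction n with
  | zero =>
    intro M _ _ _ _ xs ys _ hyl _ _ _ _
    rw [List.length_eq_zero_iff] at hyl
    subst hyl
    exact .nil R M
  | succ n ih =>
    intro M _ _ _ _ xs ys hxl hyl hxm hym hx hy
    have hdim := Module.supportDim_add_length_eq_supportDim_of_isRegular xs
      (IsRegular.of_isWeaklyRegular_of_mem_maximalIdeal M hxm hx)
    have hne : Nontrivial (M ⧸ (Ideal.ofList xs • ⊤ : Submodule R M)) :=
      (IsRegular.of_isWeaklyRegular_of_mem_maximalIdeal M hxm hx).quot_ofList_smul_nontrivial _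
    have hne := supportDim_nonneg_of_nontrivial R
      (M ⧸ (Ideal.ofList xs • ⊤ : Submodule R M))
    rw [hxl] at hdim
    obtain ⟨x, xs, rfl⟩ := List.exists_cons_of_length_eq_add_one hxl
    obtain ⟨y, ys, rfl⟩ := List.exists_cons_of_length_eq_add_one hyl
    simp only [List.mem_cons, forall_eq_or_imp, List.length_cons, Nat.add_right_cancel_iff] at *
    rw [isWeaklyRegular_cons_iff_of_mem_maximalIdeal hxm.1 hxm.2] at hx
    rw [isWeaklyRegular_cons_iff_of_mem_maximalIdeal hym.1 hym.2]
    set N := M ⧸ (Ideal.ofList ys • ⊤ : Submodule R M)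
    rw [Module.supportDim_eq_of_equiv
      (Submodule.quotOfListConsSMulTopEquivQuotSMulTopOuter M y ys)] at hy
    have hle := supportDim_le_supportDim_quotient_ofList_add_length ys hym.2 M
    have hN : ¬ Module.supportDim R N ≤ 0 := by
      intro hN
      change _ ≤ Module.supportDim R N + _ at hle
      grw [← hdim, hN, hyl] at hle
      rw [zero_add] at hle
      refine (ENat.WithBot.add_one_le_iff.1 (le_trans ?_ hle)).false
      simpa using add_le_add_left hne ((n : WithBot ℕ∞) + 1)
    obtain ⟨z, hzm, hz⟩ := Ideal.exists_mem_forall_notMem_of_finite (J := maximalIdeal R)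
      ((associatedPrimes.finite R (M ⧸ (Ideal.ofList xs • ⊤ : Submodule R M))).union
        (Module.annihilator R N).finite_minimalPrimes_of_isNoetherianRing)
      (by
        rintro p (hp | hp)
        · exact hp.1
        · exact hp.1.1)
      (by
        rintro p (hp | hp) hle
        · exact hx.2.notMem_of_mem_associatedPrimes hp (hle hxm.1)
        · have : p = maximalIdeal R := le_antisymm (le_maximalIdeal hp.1.1.ne_top) hle
          subst this
          exact hN (supportDim_nonpos_of_maximalIdeal_mem_minimalPrimes hp))
    have hzx := isSMulRegular_of_forall_notMem_associatedPrimes fun p hp ↦ hz p (.inl hp)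
    have hx' := (isWeaklyRegular_cons_iff _ _ _).1
      ((isWeaklyRegular_cons_iff_of_mem_maximalIdeal hzm hxm.2).2 ⟨hx.1, hzx⟩)
    have hzN := Module.supportDim_quotSMulTop_succ_eq_of_notMem_minimalPrimes_of_mem_maximalIdeal
      (fun p hp ↦ hz p (.inr hp)) hzm
    have hN1 := Module.supportDim_le_supportDim_quotSMulTop_succ (M := N) hym.1
    have := nontrivial_quotSMulTop_of_mem_maximalIdeal M hzm
    have hzys := ih (QuotSMulTop z M) xs ys hxl hyl hxm.2 hym.2 hx'.2 (by
      rw [Module.supportDim_eq_of_equiv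
        ((Submodule.quotOfListConsSMulTopEquivQuotSMulTopInner M z ys).symm ≪≫ₗ
          Submodule.quotOfListConsSMulTopEquivQuotSMulTopOuter M z ys)]
      change Module.supportDim R (QuotSMulTop z N) ≤ 0
      grw [← hzN, hy] at hN1
      have hlt := (ENat.WithBot.add_one_le_natCast_iff (m := 1)).1 (by simpa using hN1)
      exact (ENat.WithBot.lt_add_one_iff (m := 0)).1 (by simpa using hlt))
    have hzys' := (isWeaklyRegular_cons_iff_of_mem_maximalIdeal hzm hym.2).1
      ((isWeaklyRegular_cons_iff _ _ _).2 ⟨hx'.1, hzys⟩)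
    exact ⟨hzys'.1, isSMulRegular_of_supportDim_quotSMulTop_nonpos hzys'.2 hzm hy⟩

end Modules

section Rings

variable {R : Type*} [CommRing R]

theorem exists_colon_generator_of_isPrincipal_hom {a b : Ideal R}
    (h : (⊤ : Submodule R ((R ⧸ a) →ₗ[R] (R ⧸ b))).IsPrincipal) :
    ∃ δ, (∀ c ∈ a, c * δ ∈ b) ∧ ∀ w, (∀ c ∈ a, c * w ∈ b) → ∃ s, w - s * δ ∈ b := by
  obtain ⟨f, hf⟩ := h
  obtain ⟨δ, hδ⟩ := Ideal.Quotient.mk_surjective (f (Ideal.Quotient.mk a 1))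
  have hmk (I : Ideal R) (r s : R) :
      Ideal.Quotient.mk I (r * s) = r • Ideal.Quotient.mk I s := rfl
  refine ⟨δ, fun c hc ↦ ?_, fun w hw ↦ ?_⟩
  · rw [← Ideal.Quotient.eq_zero_iff_mem, hmk, hδ, ← map_smul, ← hmk, mul_one,
      Ideal.Quotient.eq_zero_iff_mem.2 hc, map_zero]
  · let g : (R ⧸ a) →ₗ[R] (R ⧸ b) :=
      Submodule.liftQ a (LinearMap.toSpanSingleton R (R ⧸ b) (Ideal.Quotient.mk b w))
        fun c hc ↦ by
          rw [LinearMap.mem_ker, LinearMap.toSpanSingleton_apply, ← hmk,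
            Ideal.Quotient.eq_zero_iff_mem]
          exact hw c hc
    have hg : g (Ideal.Quotient.mk a 1) = Ideal.Quotient.mk b w := by
      change (1 : R) • Ideal.Quotient.mk b w = _
      rw [one_smul]
    obtain ⟨s, hs⟩ := Submodule.mem_span_singleton.1 (hf ▸ Submodule.mem_top (x := g))
    refine ⟨s, ?_⟩
    rw [← Ideal.Quotient.eq_zero_iff_mem, map_sub, hmk, hδ, ← LinearMap.smul_apply, hs, hg,
      sub_self]

theorem isPrincipal_top_of_linearEquiv {M N : Type*} [AddCommGroup M] [Module R M]
    [AddCommGroup N] [Module R N] (e : M ≃ₗ[R] N) (h : (⊤ : Submodule R N).IsPrincipal) :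
    (⊤ : Submodule R M).IsPrincipal := by
  have := h.map e.symm.toLinearMap
  rwa [Submodule.map_top, LinearEquiv.range] at this

theorem isPrincipal_top_end_quotient (a : Ideal R) :
    (⊤ : Submodule R ((R ⧸ a) →ₗ[R] (R ⧸ a))).IsPrincipal := by
  refine ⟨LinearMap.id, (eq_top_iff.2 fun f _ ↦ ?_).symm⟩
  obtain ⟨r, hr⟩ := Ideal.Quotient.mk_surjective (f (Ideal.Quotient.mk a 1))
  refine Submodule.mem_span_singleton.2 ⟨r, ?_⟩
  ext
  exact (mul_one (Ideal.Quotient.mk a r)).trans hr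

theorem Ideal.radical_ofList_append_map_pow (us vs : List R) {n : ℕ} (hn : n ≠ 0) :
    (Ideal.ofList (us ++ vs.map fun v ↦ v ^ n)).radical = (Ideal.ofList (us ++ vs)).radical := by
  apply le_antisymm <;> rw [Ideal.radical_le_radical_iff, Ideal.span_le]
  · intro r hr
    obtain hr | hr := List.mem_append.1 hr
    · exact Ideal.le_radical (Ideal.subset_span (List.mem_append_left _ hr))
    · obtain ⟨v, hv, rfl⟩ := List.mem_map.1 hr
      have hv : v ∈ Ideal.ofList (us ++ vs) := Ideal.subset_span (List.mem_append_right _ hv)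
      exact Ideal.le_radical (Ideal.pow_mem_of_mem _ hv n (Nat.pos_of_ne_zero hn))
  · intro r hr
    obtain hr | hr := List.mem_append.1 hr
    · exact Ideal.le_radical (Ideal.subset_span (List.mem_append_left _ hr))
    · exact ⟨n, Ideal.subset_span
        (List.mem_append_right _ (List.mem_map.2 ⟨r, hr, rfl⟩))⟩

variable [IsLocalRing R]

theorem isParameterIdeal_iff_exists_list {I : Ideal R} :
    IsParameterIdeal R I ↔ ∃ xs : List R, ringKrullDim R = xs.length ∧
      (∀ r ∈ xs, r ∈ maximalIdeal R) ∧ I = Ideal.ofList xs ∧ I.radical = maximalIdeal R := by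
  constructor
  · rintro ⟨d, a, hd, ha, hI, hrad⟩
    refine ⟨List.ofFn a, by simpa using hd, by simpa [List.mem_ofFn] using ha, ?_, hrad⟩
    rw [hI, Ideal.ofList]
    congr 1
    ext r
    simp [List.mem_ofFn]
  · rintro ⟨xs, hd, hxs, hI, hrad⟩
    refine ⟨xs.length, xs.get, hd, fun i ↦ hxs _ (List.get_mem _ _), ?_, hrad⟩
    rw [hI, Ideal.ofList, Set.range_list_get]

variable [IsNoetherianRing R]

theorem isCohenMacaulayLocalRing_iff_exists_isRegular :
    IsCohenMacaulayLocalRing R ↔ ∃ xs : List R, ringKrullDim R = xs.length ∧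
      (∀ r ∈ xs, r ∈ maximalIdeal R) ∧ IsRegular R xs := by
  constructor
  · intro h
    let S : Set ℕ∞ := {n : ℕ∞ | ∃ (k : ℕ) (a : Fin k → R), (k : ℕ∞) = n ∧
      (∀ i, a i ∈ maximalIdeal R) ∧ IsRegular R (List.ofFn a)}
    have : Nonempty S := ⟨0, 0, Fin.elim0, rfl, fun i ↦ i.elim0, by simpa using IsRegular.nil R R⟩
    have hlt : sSup S < ⊤ := by
      have := ringKrullDim_lt_top (R := R)
      rw [← h] at this
      exact WithBot.coe_lt_coe.1 this
    obtain ⟨k, a, hk, ha, hreg⟩ := ENat.sSup_mem_of_nonempty_of_lt_top hlt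
    refine ⟨List.ofFn a, ?_, by simpa [List.mem_ofFn] using ha, hreg⟩
    rw [← h, List.length_ofFn]
    exact congrArg _ hk.symm
  · rintro ⟨xs, hd, hxs, hreg⟩
    rw [IsCohenMacaulayLocalRing, hd]
    refine congrArg WithBot.some (le_antisymm (sSup_le ?_) (le_sSup ?_))
    · rintro _ ⟨k, a, rfl, ha, hreg'⟩
      have hdim := ringKrullDim_add_length_eq_ringKrullDim_of_isRegular _ hreg'
      have hnt : Nontrivial (R ⧸ Ideal.ofList (List.ofFn a)) := by
        simpa using hreg'.quot_ofList_smul_nontrivial (⊤ : Ideal R)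
      have hle := add_le_add_left (ringKrullDim_nonneg_of_nontrivial
        (R := R ⧸ Ideal.ofList (List.ofFn a))) ((List.ofFn a).length : WithBot ℕ∞)
      rw [hdim, hd, List.length_ofFn, zero_add] at hle
      exact WithBot.coe_le_coe.1 hle
    · refine ⟨xs.length, xs.get, rfl, fun i ↦ hxs _ (List.get_mem _ _), ?_⟩
      rwa [List.ofFn_get]

theorem Ideal.mem_of_forall_mem_sup_pow_s7 {I J : Ideal R} (hJ : J ≠ ⊤) {w : R}
    (h : ∀ n, w ∈ I ⊔ J ^ n) : w ∈ I := by
  have hw : (Submodule.Quotient.mk w : R ⧸ I) ∈ (⨅ n : ℕ, J ^ n • ⊤ : Submodule R (R ⧸ I)) := by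
    rw [Submodule.mem_iInf]
    intro n
    obtain ⟨i, hi, j, hj, rfl⟩ := Submodule.mem_sup.1 (h n)
    have : (Submodule.Quotient.mk (i + j) : R ⧸ I) = j • Submodule.Quotient.mk (p := I) 1 := by
      rw [← Submodule.Quotient.mk_smul, Submodule.Quotient.eq]
      simpa using hi
    rw [this]
    exact Submodule.smul_mem_smul hj trivial
  rw [Ideal.iInf_pow_smul_eq_bot_of_isLocalRing _ hJ] at hw
  exact (Submodule.Quotient.mk_eq_zero I).1 hw

theorem mem_of_mul_mem_of_isPrincipal_hom {I : Ideal R} {x w : R} (hx : x ∈ maximalIdeal R)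
    (hxI : x ∉ I.radical)
    (h : ∀ n : ℕ, (⊤ : Submodule R ((R ⧸ (Ideal.span {x} ⊔ I)) →ₗ[R]
      (R ⧸ (Ideal.span {x ^ (n + 1)} ⊔ I)))).IsPrincipal)
    (hw : x * w ∈ I) : w ∈ I := by
  refine Ideal.mem_of_forall_mem_sup_pow_s7 (J := maximalIdeal R) Ideal.IsPrime.ne_top' fun n ↦ ?_
  obtain ⟨δ, hδ, hgen⟩ := exists_colon_generator_of_isPrincipal_hom (h n)
  have hmem {v : R} (hv : x * v ∈ Ideal.span {x ^ (n + 1)} ⊔ I) :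
      ∀ c ∈ Ideal.span {x} ⊔ I, c * v ∈ Ideal.span {x ^ (n + 1)} ⊔ I := by
    intro c hc
    obtain ⟨_, hc₁, i, hi, rfl⟩ := Submodule.mem_sup.1 hc
    obtain ⟨r, rfl⟩ := Ideal.mem_span_singleton'.1 hc₁
    rw [add_mul, mul_assoc]
    exact add_mem (Ideal.mul_mem_left _ _ hv) (Ideal.mem_sup_right (I.mul_mem_right _ hi))
  have hexpand {v : R} (hv : v ∈ Ideal.span {x ^ (n + 1)} ⊔ I) :
      ∃ e, ∃ i ∈ I, e * x ^ (n + 1) + i = v := by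
    obtain ⟨_, hv₁, i, hi, rfl⟩ := Submodule.mem_sup.1 hv
    obtain ⟨r, rfl⟩ := Ideal.mem_span_singleton'.1 hv₁
    exact ⟨r, i, hi, rfl⟩
  obtain ⟨r, hr⟩ := hgen (x ^ n) (hmem (by
    rw [← pow_succ']
    exact Ideal.mem_sup_left (Ideal.mem_span_singleton_self _)))
  obtain ⟨s, hs⟩ := hgen w (hmem (Ideal.mem_sup_right hw))
  obtain ⟨e, i, hi, hr⟩ := hexpand hr
  obtain ⟨e', i', hi', hs⟩ := hexpand hs
  obtain ⟨c, j, hj, hc⟩ := hexpand (hδ x (Ideal.mem_sup_left (Ideal.mem_span_singleton_self _)))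
  have hru : IsUnit r := by
    by_contra hrm
    have hu : IsUnit (1 - (r * c + e * x)) := by
      by_contra hu
      refine (maximalIdeal R).ne_top_iff_one.1 Ideal.IsPrime.ne_top' ?_
      rw [← sub_add_cancel 1 (r * c + e * x)]
      exact add_mem hu (add_mem (Ideal.mul_mem_right _ _ hrm) (Ideal.mul_mem_left _ _ hx))
    refine hxI ⟨n + 1, (Ideal.unit_mul_mem_iff_mem I hu).1 ?_⟩
    have : (1 - (r * c + e * x)) * x ^ (n + 1) = r * j + x * i := by
      linear_combination (-x) * hr - r * hc
    rw [this]
    exact add_mem (I.mul_mem_left _ hj) (I.mul_mem_left _ hi)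
  obtain ⟨u, rfl⟩ := hru
  have : w = i' - s * ↑u⁻¹ * i + (s * ↑u⁻¹ + e' * x - s * ↑u⁻¹ * e * x) * x ^ n := by
    linear_combination (-1 : R) * hs + s * ↑u⁻¹ * hr - s * δ * u.inv_mul
  rw [this]
  exact add_mem (Ideal.mem_sup_left (sub_mem hi' (I.mul_mem_left _ hi)))
    (Ideal.mem_sup_right (Ideal.mul_mem_left _ _ (Ideal.pow_mem_pow hx n)))

theorem ringKrullDim_le_length_of_radical_ofList_eq {xs : List R}
    (h : (Ideal.ofList xs).radical = maximalIdeal R) : ringKrullDim R ≤ xs.length := by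
  classical
  have hs : Ideal.ofList xs = Ideal.span (xs.toFinset : Set R) := by simp [Ideal.ofList]
  rw [← maximalIdeal_height_eq_ringKrullDim]
  have hmin : maximalIdeal R ∈ (Ideal.span (xs.toFinset : Set R)).minimalPrimes := by
    rw [← hs, ← Ideal.radical_minimalPrimes, h, Ideal.minimalPrimes_eq_subsingleton_self]
    rfl
  have := Ideal.height_le_card_of_mem_minimalPrimes_span_finset hmin
  exact WithBot.coe_le_coe.2 (this.trans (by exact_mod_cast xs.toFinset_card_le))

variable (R) in
theorem exists_list_radical_ofList_eq_maximalIdeal :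
    ∃ xs : List R, ringKrullDim R = xs.length ∧ (∀ r ∈ xs, r ∈ maximalIdeal R) ∧
      (Ideal.ofList xs).radical = maximalIdeal R := by
  obtain ⟨s, hs, hcard⟩ :=
    (maximalIdeal R).exists_finset_card_eq_height_of_isNoetherianRing
  have hofList : Ideal.ofList s.toList = Ideal.span (s : Set R) := by simp [Ideal.ofList]
  refine ⟨s.toList, ?_, fun r hr ↦ hs.1.2 (Ideal.subset_span (by simpa using hr)), ?_⟩
  · rw [← maximalIdeal_height_eq_ringKrullDim, ← hcard, Finset.length_toList]
    rfl
  · rw [hofList]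
    refine le_antisymm (hs.1.1.radical_le_iff.2 hs.1.2) ?_
    rw [Ideal.radical_eq_sInf, le_sInf_iff]
    exact fun p hp ↦ hs.2 ⟨hp.2, hp.1⟩ (le_maximalIdeal hp.2.ne_top)

theorem isWeaklyRegular_of_isParameterIdeal_of_isRegular {xs ys : List R}
    (hxd : ringKrullDim R = xs.length) (hxm : ∀ r ∈ xs, r ∈ maximalIdeal R)
    (hx : IsRegular R xs) (hyd : ringKrullDim R = ys.length)
    (hym : ∀ r ∈ ys, r ∈ maximalIdeal R)
    (hrad : (Ideal.ofList ys).radical = maximalIdeal R) : IsWeaklyRegular R ys := by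
  have hlen : ys.length = xs.length := by
    have := hyd.symm.trans hxd
    exact_mod_cast this
  refine isWeaklyRegular_of_isWeaklyRegular_of_supportDim_nonpos xs.length R xs ys rfl hlen hxm
    hym hx.toIsWeaklyRegular ?_
  rw [supportDim_nonpos_iff_support_subset, Module.support_quotient,
    ← PrimeSpectrum.zeroLocus_radical (Ideal.ofList ys), hrad]
  exact Set.inter_subset_right

theorem isWeaklyRegular_of_forall_isPrincipal_hom
    (h : ∀ a b : Ideal R, IsParameterIdeal R a → IsParameterIdeal R b → b ≤ a →
      (⊤ : Submodule R ((R ⧸ a) →ₗ[R] (R ⧸ b))).IsPrincipal)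
    {xs : List R} (hd : ringKrullDim R = xs.length) (hm : ∀ r ∈ xs, r ∈ maximalIdeal R)
    (hrad : (Ideal.ofList xs).radical = maximalIdeal R) : IsWeaklyRegular R xs := by
  refine ⟨fun k hk ↦ ?_⟩
  have hxs := (List.take_append_drop k xs).symm
  rw [List.drop_eq_getElem_cons hk] at hxs
  generalize xs[k] = x, xs.take k = us, xs.drop (k + 1) = vs at *
  subst hxs
  have hlen : (us ++ x :: vs).length = us.length + vs.length + 1 := by simp; omega
  simp only [List.mem_append, List.mem_cons] at hm
  have hxm : x ∈ maximalIdeal R := hm x (by simp)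
  -- the ideals generated by `us`, `x ^ (m + 1)` and the `(n + 1)`-st powers of `vs`
  have hparam (m n : ℕ) : IsParameterIdeal R
      (Ideal.span {x ^ (m + 1)} ⊔ Ideal.ofList (us ++ vs.map fun v ↦ v ^ (n + 1))) := by
    refine isParameterIdeal_iff_exists_list.2
      ⟨x ^ (m + 1) :: (us ++ vs.map fun v ↦ v ^ (n + 1)), ?_, ?_, (Ideal.ofList_cons _ _).symm, ?_⟩
    · rw [hd, hlen]
      simp
    · intro r hr
      simp only [List.mem_cons, List.mem_append, List.mem_map] at hr
      obtain rfl | hr | ⟨v, hv, rfl⟩ := hr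
      · exact Ideal.pow_mem_of_mem _ hxm _ m.succ_pos
      · exact hm r (by simp [hr])
      · exact Ideal.pow_mem_of_mem _ (hm v (by simp [hv])) _ n.succ_pos
    · rw [← hrad, Ideal.radical_sup, Ideal.radical_ofList_append_map_pow us vs n.succ_ne_zero,
        ← Ideal.span_singleton_pow, Ideal.radical_pow _ m.succ_ne_zero, ← Ideal.radical_sup,
        Ideal.ofList_append, Ideal.ofList_append, Ideal.ofList_cons, sup_left_comm]
  refine (isSMulRegular_iff_right_eq_zero_of_smul).2 fun q hq ↦ ?_
  obtain ⟨w, rfl⟩ := Submodule.Quotient.mk_surjective _ q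
  rw [← Submodule.Quotient.mk_smul, Submodule.Quotient.mk_eq_zero, smul_eq_mul, Ideal.mul_top] at hq
  rw [Submodule.Quotient.mk_eq_zero, smul_eq_mul, Ideal.mul_top]
  refine Ideal.mem_of_forall_mem_sup_pow_s7 (J := maximalIdeal R) Ideal.IsPrime.ne_top' fun n ↦ ?_
  have hw : w ∈ Ideal.ofList (us ++ vs.map fun v ↦ v ^ (n + 1)) := by
    refine mem_of_mul_mem_of_isPrincipal_hom hxm (fun hxr ↦ ?_) (fun m ↦ ?_) ?_
    · have hle := ringKrullDim_le_length_of_radical_ofList_eq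
        (xs := us ++ vs.map fun v ↦ v ^ (n + 1)) (le_antisymm ?_ ?_)
      · rw [hd, hlen, List.length_append, List.length_map] at hle
        have : us.length + vs.length + 1 ≤ us.length + vs.length := by exact_mod_cast hle
        omega
      · obtain ⟨-, -, -, -, -, hr⟩ := hparam 0 n
        exact (Ideal.radical_mono le_sup_right).trans hr.le
      · obtain ⟨-, -, -, -, -, hr⟩ := hparam 0 n
        rw [← hr, Ideal.radical_le_radical_iff, zero_add, pow_one]
        exact sup_le ((Ideal.span_singleton_le_iff_mem _).2 hxr) Ideal.le_radical
    · refine h _ _ (by simpa using hparam 0 n) (hparam m n) (sup_le_sup_right ?_ _)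
      rw [Ideal.span_singleton_le_span_singleton]
      exact dvd_pow_self x m.succ_ne_zero
    · exact Ideal.span_mono (fun r hr ↦ List.mem_append_left _ hr) hq
  rw [Ideal.ofList_append] at hw
  have hle : Ideal.ofList (vs.map fun v ↦ v ^ (n + 1)) ≤ maximalIdeal R ^ n := by
    refine Ideal.span_le.2 fun r hr ↦ ?_
    obtain ⟨v, hv, rfl⟩ := List.mem_map.1 hr
    exact Ideal.pow_le_pow_right n.le_succ (Ideal.pow_mem_pow (hm v (by simp [hv])) _)
  exact sup_le_sup le_rfl hle hw

end Rings

theorem isCohenMacaulay_iff_hom_quotient_cyclic (R : Type*) [CommRing R] [IsNoetherianRing R] [IsLocalRing R] :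
    IsCohenMacaulayLocalRing R ↔
      ∀ a b : Ideal R, IsParameterIdeal R a → IsParameterIdeal R b → b ≤ a →
        Submodule.IsPrincipal (⊤ : Submodule R ((R ⧸ a) →ₗ[R] (R ⧸ b))) := by
  rw [isCohenMacaulayLocalRing_iff_exists_isRegular]
  constructor
  · rintro ⟨xs, hxd, hxm, hx⟩ a b ha hb hba
    obtain ⟨as, had, ham, rfl, harad⟩ := isParameterIdeal_iff_exists_list.1 ha
    obtain ⟨bs, hbd, hbm, rfl, hbrad⟩ := isParameterIdeal_iff_exists_list.1 hb
    have hlen : bs.length = as.length := by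
      have := hbd.symm.trans had
      exact_mod_cast this
    obtain ⟨e⟩ := nonempty_hom_quotient_ofList_equiv (N := R ⧸ Ideal.ofList as)
      (Ideal.span_le.2 ham) Ideal.annihilator_quotient.ge as.length R bs as hlen rfl
      (fun r hr ↦ hba (Ideal.subset_span hr)) (fun r hr ↦ Ideal.subset_span hr)
      (isWeaklyRegular_of_isParameterIdeal_of_isRegular hxd hxm hx hbd hbm hbrad)
      (isWeaklyRegular_of_isParameterIdeal_of_isRegular hxd hxm hx had ham harad)
    have hq (rs : List R) : (Ideal.ofList rs • ⊤ : Ideal R) = Ideal.ofList rs := by simp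
    rw [hq, hq] at e
    exact isPrincipal_top_of_linearEquiv e (isPrincipal_top_end_quotient _)
  · intro h
    obtain ⟨xs, hd, hm, hrad⟩ := exists_list_radical_ofList_eq_maximalIdeal R
    exact ⟨xs, hd, hm, .of_isWeaklyRegular_of_mem_maximalIdeal R hm
      (isWeaklyRegular_of_forall_isPrincipal_hom h hd hm hrad)⟩
end
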